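/- Let α, β, γ, δ ∈ ℂ be algebraically independent over ℚ. Let L be a differential field extension of ℂ(t) with derivation D, K a differential subfield of L, n ≥ 2, and let y₁, …, yₙ ∈ L be solutions (with each yᵢ ≠ 0) of the third Painlevé equation y'' = (1/y)(y')² − (1/t)y' + (1/t)(αy² + β) + γy³ + δ/y. If the 2n elements y₁, y₁', …, yₙ, yₙ' are NOT algebraically independent over K, then there exist 1 ≤ i < j ≤ n such that yᵢ, yᵢ', yⱼ, yⱼ' are not algebraically independent over K. (Geometric triviality of generic P_III; the paper's main result, as in the abstract, for the family P_III.) -/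

import Mathlib

theorem Polynomial.exists_sub_eq_two_mul_of_derivative_eq {k : Type*} [Field k] [CharZero k]
    {φ : Polynomial k} (hφ : φ ≠ 0) {e b : k}
    (h : (1 - Polynomial.X ^ 2) * Polynomial.derivative φ =
      (Polynomial.C e - Polynomial.C b * Polynomial.X) * φ) :
    ∃ p : ℕ, b - e = 2 * p := by
  obtain ⟨ψ, hψ, hnd⟩ := Polynomial.exists_eq_pow_rootMultiplicity_mul_and_not_dvd φ hφ 1
  generalize φ.rootMultiplicity 1 = p at hψ
  refine ⟨p, ?_⟩
  have hev : ψ.eval 1 ≠ 0 := by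
    intro h0
    exact hnd (Polynomial.dvd_iff_isRoot.2 h0)
  have hX : (Polynomial.X - Polynomial.C (1 : k)) ^ p ≠ 0 :=
    pow_ne_zero _ (Polynomial.X_sub_C_ne_zero 1)
  have hpow : (Polynomial.X - Polynomial.C (1 : k)) *
      Polynomial.derivative ((Polynomial.X - Polynomial.C (1 : k)) ^ p) =
      (p : Polynomial k) * (Polynomial.X - Polynomial.C (1 : k)) ^ p := by
    rw [Polynomial.derivative_X_sub_C_pow]
    rcases p with _ | p
    · simp
    · simp only [Nat.add_sub_cancel, map_natCast]
      ring
  have key : (Polynomial.X - Polynomial.C (1 : k)) ^ p *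
      (-(1 + Polynomial.X) * ((p : Polynomial k) * ψ + (Polynomial.X - Polynomial.C 1) * Polynomial.derivative ψ)) =
      (Polynomial.X - Polynomial.C (1 : k)) ^ p *
      ((Polynomial.C e - Polynomial.C b * Polynomial.X) * ψ) := by
    rw [hψ, Polynomial.derivative_mul] at h
    simp only [map_one] at *
    linear_combination h + (1 + Polynomial.X) * ψ * hpow
  have key2 := congrArg (Polynomial.eval 1) (mul_left_cancel₀ hX key)
  simp at key2
  have : (b - e - 2 * p) * ψ.eval 1 = 0 := by linear_combination key2
  rcases mul_eq_zero.1 this with h | h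
  · linear_combination h
  · exact absurd h hev

theorem exists_int_recurrence {k : Type*} [Field k] [CharZero k] (e A u₀ : k) (S : ℤ → k)
    (hS : ∀ j ≤ 0, S j = 0) :
    ∃ u : ℤ → k, (∀ j < 0, u j = 0) ∧ u 0 = u₀ ∧
      ∀ j : ℤ, (j : k) * u j + (A - j) * u (j - 2) - e * u (j - 1) = S j := by
  let step : ℕ → k × k → k × k := fun n v =>
    ((S (n + 1) - (A - (n + 1)) * v.2 + e * v.1) / (n + 1), v.1)
  let v : ℕ → k × k := fun n => Nat.rec (u₀, 0) step n
  have hv : ∀ n, v (n + 1) = step n (v n) := fun n => rfl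
  let u : ℤ → k := fun j => if j < 0 then 0 else (v j.toNat).1
  have hneg : ∀ j < 0, u j = 0 := fun j hj => by simp [u, hj]
  have hnat : ∀ n : ℕ, u n = (v n).1 := fun n => by
    have : ¬ ((n : ℤ) < 0) := by omega
    simp [u, this]
  have hnat2 : ∀ n : ℕ, u (n - 1) = (v n).2 := fun n => by
    rcases n with _ | n
    · exact hneg _ (by simp)
    · rw [show ((n + 1 : ℕ) : ℤ) - 1 = n by push_cast; ring, hnat, hv]
  refine ⟨u, hneg, by simpa [v] using hnat 0, fun j => ?_⟩
  rcases lt_trichotomy j 0 with hj | rfl | hj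
  · rw [hneg _ hj, hneg _ (by omega), hneg _ (by omega), hS _ hj.le]; ring
  · rw [hneg (0 - 2) (by omega), hneg (0 - 1) (by omega), hS _ le_rfl]; simp
  · obtain ⟨n, rfl⟩ : ∃ n : ℕ, j = n + 1 := ⟨(j - 1).toNat, by omega⟩
    rw [show ((n : ℤ) + 1 - 2) = n - 1 by ring, show ((n : ℤ) + 1 - 1) = n by ring, hnat, hnat2,
      show ((n : ℤ) + 1) = ((n + 1 : ℕ) : ℤ) by push_cast; ring, hnat, hv]
    have : (n + 1 : k) ≠ 0 := by exact_mod_cast Nat.succ_ne_zero n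
    simp only [step]
    push_cast
    field_simp
    ring

theorem eq_zero_of_int_recurrence {k : Type*} [Field k] [CharZero k] (e A : k) (d : ℤ)
    (T : ℤ → ℤ → k) (h1 : ∀ j l, j < 0 → T j l = 0)
    (h3 : ∀ j l, d < l → T j l = 0) (h4 : ∀ l, T 0 l = 0)
    (hT : ∀ j l : ℤ, (j : k) * T j l + (A - j + l) * T (j - 2) l + (l + 1) * T j (l + 1)
      + 2 * (d - l + 1) * T (j - 2) (l - 1) = e * T (j - 1) l) (j l : ℤ) : T j l = 0 := by
  have main : ∀ n : ℕ, ∀ j : ℤ, j ≤ n → ∀ l, T j l = 0 := by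
    intro n
    induction n with
    | zero =>
      intro j hj l
      rcases lt_or_eq_of_le hj with h | h
      · exact h1 _ _ h
      · have : j = 0 := by simpa using h
        rw [this]; exact h4 l
    | succ n ih =>
      intro j hj
      by_cases hjn : j ≤ n
      · exact ih j hjn
      have hj0 : (j : k) ≠ 0 := by
        have : j ≠ 0 := by omega
        exact_mod_cast this
      have desc : ∀ m : ℕ, ∀ l : ℤ, d - m < l → T j l = 0 := by
        intro m
        induction m with
        | zero => intro l hl; exact h3 _ _ (by simpa using hl)
        | succ m ihm =>
          intro l hl
          have h := hT j l
          rw [ih (j - 2) (by omega), ih (j - 2) (by omega), ih (j - 1) (by omega),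
            ihm (l + 1) (by push_cast at hl; omega)] at h
          have : (j : k) * T j l = 0 := by linear_combination h
          exact (mul_eq_zero.1 this).resolve_left hj0
      intro l
      exact desc (d - l + 1).toNat l (by omega)
  exact main j.toNat j (by omega) l

theorem Polynomial.exists_coeff_eq_of_int {k : Type*} [Field k] (u : ℤ → k) (N : ℤ)
    (hN : ∀ j, N < j → u j = 0) : ∃ φ : Polynomial k, ∀ n : ℕ, φ.coeff n = u n := by
  refine ⟨∑ n ∈ Finset.range (N + 1).toNat, Polynomial.C (u n) * Polynomial.X ^ n, fun n => ?_⟩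
  simp only [Polynomial.finsetSum_coeff, Polynomial.coeff_C_mul, Polynomial.coeff_X_pow, mul_ite,
    mul_one, mul_zero, Finset.sum_ite_eq, Finset.mem_range]
  split_ifs with h
  · rfl
  · exact (hN _ (by omega)).symm

theorem Polynomial.coeff_one_sub_sq_mul_derivative_sub {k : Type*} [Field k] {u : ℤ → k}
    {φ : Polynomial k} (hφ : ∀ n : ℕ, φ.coeff n = u n) (hneg : ∀ j < 0, u j = 0) (e b : k)
    (n : ℕ) :
    ((1 - Polynomial.X ^ 2) * Polynomial.derivative φ -
      (Polynomial.C e - Polynomial.C b * Polynomial.X) * φ).coeff n =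
      ((n + 1 : ℤ) : k) * u (n + 1) + (b + 1 - n) * u (n - 1) - e * u n := by
  have hsplit : (1 - Polynomial.X ^ 2) * Polynomial.derivative φ -
      (Polynomial.C e - Polynomial.C b * Polynomial.X) * φ =
      Polynomial.derivative φ - Polynomial.X ^ 2 * Polynomial.derivative φ -
      Polynomial.C e * φ + Polynomial.C b * (Polynomial.X ^ 1 * φ) := by ring
  rw [hsplit]
  simp only [Polynomial.coeff_add, Polynomial.coeff_sub, Polynomial.coeff_C_mul,
    Polynomial.coeff_X_pow_mul', Polynomial.coeff_derivative, hφ]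
  rcases n with _ | _ | n
  · simp [hneg (-1) (by norm_num)]
  · simp
    ring
  · rw [if_pos (by omega), if_pos (by omega), show n + 1 + 1 - 2 = n by omega,
      show n + 1 + 1 - 1 = n + 1 by omega]
    push_cast
    rw [show (n : ℤ) + 1 + 1 - 1 = n + 1 by ring]
    ring

theorem exists_int_signed_choose (k : Type*) [Field k] (d : ℕ) :
    ∃ B : ℤ → k, (∀ l, ∃ z : ℤ, B l = z) ∧ B 0 = 1 ∧ (∀ l < 0, B l = 0) ∧ (∀ l, (d : ℤ) < l → B l = 0) ∧
      ∀ l : ℤ, (l + 1) * B (l + 1) = -((d : k) - l) * B l := by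
  refine ⟨fun l => if l < 0 then 0 else (-1) ^ l.toNat * (d.choose l.toNat : k),
    fun l => ⟨if l < 0 then 0 else (-1) ^ l.toNat * (d.choose l.toNat : ℤ), by push_cast; rfl⟩,
    by simp, fun l hl => by simp [hl], fun l hl => ?_, fun l => ?_⟩
  · have : d < l.toNat := by omega
    simp [Nat.choose_eq_zero_of_lt this]
  · rcases lt_trichotomy l (-1) with h | rfl | h
    · simp [show l < 0 by omega, show l + 1 < 0 by omega]
    · simp
    · obtain ⟨n, rfl⟩ : ∃ n : ℕ, l = n := ⟨l.toNat, by omega⟩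
      beta_reduce
      rw [if_neg (by omega), if_neg (by omega), show ((n : ℤ) + 1).toNat = n + 1 by omega,
        Int.toNat_natCast]
      rcases le_or_gt n d with hnd | hnd
      · have hc : ((d.choose (n + 1) * (n + 1) : ℕ) : k) = (d.choose n * (d - n) : ℕ) :=
          congrArg _ (Nat.choose_succ_right_eq d n)
        push_cast [Nat.cast_sub hnd] at hc ⊢
        rw [pow_succ]
        linear_combination (-(-1) ^ n) * hc
      · rw [Nat.choose_eq_zero_of_lt hnd, Nat.choose_eq_zero_of_lt (by omega)]; simp

/-- The normalised recurrence. -/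
theorem edge_value {k : Type*} [Field k] [CharZero k] (κ : Derivation ℤ k k)
    (α F₁ F₂ e E lam : k) (d : ℕ) (a : ℤ) (c : ℤ → ℤ → ℤ → k) (N : ℤ)
    (hl0 : ∀ j i l, l < 0 → c j i l = 0) (hld : ∀ j i l, (d : ℤ) < l → c j i l = 0)
    (hN : ∀ j i l, N < j → c j i l = 0) (ha : ∀ j i l, a < i → c j i l = 0)
    (haj : ∀ j l, j ≠ 0 → c j a l = 0) (h1 : c 0 a 0 = 1)
    (hrec : ∀ j i l : ℤ, κ (c j i l) + j * c j i l + j * c j (i - 1) l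
      + (i + 1) * (c (j - 2) (i + 1) l + α * c (j - 1) (i + 1) l + F₁ * c (j + 1) (i + 1) l
        + F₂ * c (j + 2) (i + 1) l)
      + (l + 1) * c j i (l + 1)
      + (d - l + 1) * (2 * c (j - 2) i (l - 1) + α * c (j - 1) i (l - 1)
        - F₁ * c (j + 1) i (l - 1) - 2 * F₂ * c (j + 2) i (l - 1))
      = e * c (j - 1) i l + lam * c j i l + E * c (j + 1) i l) :
    ∃ m : ℤ, c 0 (a - 1) 0 = a + m * α - lam := by
  -- the support lies in the half space `j + i - l ≤ a`
  have hw : ∀ j i l, a < j + i - l → c j i l = 0 := by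
    by_contra! hcon
    obtain ⟨j₀, i₀, l₀, hlt, hne⟩ := hcon
    obtain ⟨w, ⟨⟨j₁, i₁, l₁, hne₁, hw₁⟩, hwmax⟩⟩ := Int.exists_greatest_of_bdd
      (P := fun w => ∃ j i l, c j i l ≠ 0 ∧ j + i - l = w)
      ⟨N + a, by
        rintro z ⟨j, i, l, h, rfl⟩
        have h1 : ¬ N < j := fun h' => h (hN _ _ _ h')
        have h2 : ¬ a < i := fun h' => h (ha _ _ _ h')
        have h3 : ¬ l < 0 := fun h' => h (hl0 _ _ _ h')
        omega⟩ ⟨_, j₀, i₀, l₀, hne, rfl⟩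
    obtain ⟨i, ⟨⟨j, l, hne₂, hw₂⟩, himax⟩⟩ := Int.exists_greatest_of_bdd
      (P := fun i => ∃ j l, c j i l ≠ 0 ∧ j + i - l = w)
      ⟨a, by
        rintro z ⟨j, l, h, -⟩
        by_contra h'
        exact h (ha _ _ _ (by omega))⟩ ⟨_, j₁, l₁, hne₁, hw₁⟩
    have hwgt : ∀ j i l, w < j + i - l → c j i l = 0 := by
      intro j i l h
      by_contra h'
      have := hwmax _ ⟨j, i, l, h', rfl⟩
      omega
    have higt : ∀ j' i' l', w = j' + i' - l' → i < i' → c j' i' l' = 0 := by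
      intro j' i' l' h hi
      by_contra h'
      have := himax _ ⟨j', l', h', h.symm⟩
      omega
    have hwa : a < w := lt_of_lt_of_le hlt (hwmax _ ⟨j₀, i₀, l₀, hne, rfl⟩)
    have hjz : ∀ j' l', w = j' + i - l' → j' ≠ 0 → c j' i l' = 0 := by
      intro j' l' h hj'
      have hr := hrec j' (i + 1) l'
      rw [hwgt j' (i + 1) l' (by omega), hwgt (j' - 1) (i + 1 + 1) l' (by omega),
        hwgt (j' + 1) (i + 1 + 1) l' (by omega), hwgt (j' + 2) (i + 1 + 1) l' (by omega),
        hwgt (j' - 1) (i + 1) (l' - 1) (by omega), hwgt (j' + 1) (i + 1) (l' - 1) (by omega),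
        hwgt (j' + 2) (i + 1) (l' - 1) (by omega), hwgt (j' + 1) (i + 1) l' (by omega),
        higt (j' - 2) (i + 1 + 1) l' (by omega) (by omega),
        higt j' (i + 1) (l' + 1) (by omega) (by omega),
        higt (j' - 2) (i + 1) (l' - 1) (by omega) (by omega),
        higt (j' - 1) (i + 1) l' (by omega) (by omega), show i + 1 - 1 = i by ring, map_zero] at hr
      have h0 : (j' : k) * c j' i l' = 0 := by linear_combination hr
      exact (mul_eq_zero.1 h0).resolve_left (by exact_mod_cast hj')
    have hj : j = 0 := by
      by_contra hj
      exact hne₂ (hjz j l hw₂.symm hj)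
    subst hj
    have hr := hrec 0 i (l - 1)
    rw [hwgt 0 i (l - 1) (by omega), hwgt (0 - 1) (i + 1) (l - 1) (by omega),
      hwgt (0 + 1) (i + 1) (l - 1) (by omega), hwgt (0 + 2) (i + 1) (l - 1) (by omega),
      hwgt (0 - 1) i (l - 1 - 1) (by omega), hwgt (0 + 1) i (l - 1 - 1) (by omega),
      hwgt (0 + 2) i (l - 1 - 1) (by omega), hwgt (0 + 1) i (l - 1) (by omega),
      higt (0 - 2) (i + 1) (l - 1) (by omega) (by omega),
      hjz (0 - 2) (l - 1 - 1) (by omega) (by omega),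
      hjz (0 - 1) (l - 1) (by omega) (by omega), show l - 1 + 1 = l by ring, map_zero] at hr
    have h0 : (l : k) * c 0 i l = 0 := by
      push_cast at hr
      linear_combination hr
    have hl : (l : k) = 0 := (mul_eq_zero.1 h0).resolve_right hne₂
    have hl' : l = 0 := by exact_mod_cast hl
    exact hne₂ (ha _ _ _ (by omega))
  have hn1 : c 0 a 1 = lam := by
    have hr := hrec 0 a 0
    rw [h1, Derivation.map_one_eq_zero, ha _ (a + 1), ha _ (a + 1), ha _ (a + 1), ha _ (a + 1),
      hl0 _ _ (0 - 1), hl0 _ _ (0 - 1), hl0 _ _ (0 - 1), hl0 _ _ (0 - 1), haj (0 - 1) 0,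
      haj (0 + 1) 0] at hr <;> try omega
    push_cast at hr
    linear_combination hr
  set p : ℤ → ℤ → k := fun j l => c j (a - j + l) l with hp
  set q : ℤ → ℤ → k := fun j l => c j (a - 1 - j + l) l with hq
  have L0 : ∀ j l : ℤ, (j : k) * p j l + ((a + 2 : k) - j + l) * p (j - 2) l + (l + 1) * p j (l + 1)
      + 2 * (((d : ℕ) : ℤ) - l + 1) * p (j - 2) (l - 1) = e * p (j - 1) l := by
    intro j l
    have hr := hrec j (a + 1 - j + l) l
    rw [hw j (a + 1 - j + l) l (by omega), hw (j - 1) (a + 1 - j + l + 1) l (by omega),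
      hw (j + 1) (a + 1 - j + l + 1) l (by omega), hw (j + 2) (a + 1 - j + l + 1) l (by omega),
      hw (j - 1) (a + 1 - j + l) (l - 1) (by omega), hw (j + 1) (a + 1 - j + l) (l - 1) (by omega),
      hw (j + 2) (a + 1 - j + l) (l - 1) (by omega), hw (j + 1) (a + 1 - j + l) l (by omega),
      map_zero, show a + 1 - j + l - 1 = a - j + l by ring,
      show a + 1 - j + l + 1 = a - (j - 2) + l by ring] at hr
    simp only [hp]
    rw [show a - j + (l + 1) = a + 1 - j + l by ring,
      show a - (j - 2) + (l - 1) = a + 1 - j + l by ring,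
      show a - (j - 1) + l = a + 1 - j + l by ring]
    push_cast at hr ⊢
    linear_combination hr
  have L1 : ∀ j l : ℤ, κ (p j l) + (j : k) * p j l + j * q j l
      + ((a + 1 : k) - j + l) * (q (j - 2) l + α * p (j - 1) l) + (l + 1) * q j (l + 1)
      + (((d : ℕ) : ℤ) - l + 1) * (2 * q (j - 2) (l - 1) + α * p (j - 1) (l - 1))
      = e * q (j - 1) l + lam * p j l := by
    intro j l
    have hr := hrec j (a - j + l) l
    rw [hw (j + 1) (a - j + l + 1) l (by omega), hw (j + 2) (a - j + l + 1) l (by omega),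
      hw (j + 1) (a - j + l) (l - 1) (by omega),
      hw (j + 2) (a - j + l) (l - 1) (by omega), hw (j + 1) (a - j + l) l (by omega)] at hr
    simp only [hp, hq]
    rw [show a - 1 - j + l = a - j + l - 1 by ring,
      show a - 1 - (j - 2) + l = a - j + l + 1 by ring,
      show a - 1 - j + (l + 1) = a - j + l by ring,
      show a - 1 - (j - 2) + (l - 1) = a - j + l by ring,
      show a - 1 - (j - 1) + l = a - j + l by ring,
      show a - (j - 1) + l = a - j + l + 1 by ring,
      show a - (j - 1) + (l - 1) = a - j + l by ring]
    push_cast at hr ⊢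
    linear_combination hr
  have hpneg : ∀ j l, j < 0 → p j l = 0 := fun j l hj => by
    by_cases hl : l < 0
    · exact hl0 _ _ _ hl
    · exact ha _ _ _ (by omega)
  have hqneg : ∀ j l, j < 0 → q j l = 0 := fun j l hj => by
    by_cases hl : l < 0
    · exact hl0 _ _ _ hl
    · by_cases h : a < a - 1 - j + l
      · exact ha _ _ _ h
      · have hj' : j = -1 := by omega
        have hl' : l = 0 := by omega
        subst hj' hl'
        simpa [hq] using haj (-1) 0 (by norm_num)
  have hp0 : ∀ l, l ≠ 0 → p 0 l = 0 := fun l hl => by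
    by_cases hl : l < 0
    · exact hl0 _ _ _ hl
    · exact ha _ _ _ (by omega)
  have hq0 : ∀ l, l ≠ 0 → l ≠ 1 → q 0 l = 0 := fun l hl hl1 => by
    by_cases hl : l < 0
    · exact hl0 _ _ _ hl
    · exact ha _ _ _ (by omega)
  have hp00 : p 0 0 = 1 := by simpa [hp] using h1
  have hq01 : q 0 1 = lam := by simpa [hq] using hn1
  have hq00 : q 0 0 = c 0 (a - 1) 0 := by simp [hq]
  obtain ⟨B, hBz, hB0, hBneg, hBd, hBrec⟩ := exists_int_signed_choose k d
  have hBrec' : ∀ l : ℤ, (((d : ℕ) : k) - l + 1) * B (l - 1) = -l * B l := by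
    intro l
    have := hBrec (l - 1)
    rw [sub_add_cancel] at this
    push_cast at this
    linear_combination this
  obtain ⟨u, huneg, hu0, hu⟩ := exists_int_recurrence (k := k) e (a - d + 2) 1 (fun _ => 0)
    (fun _ _ => rfl)
  have hpu : ∀ j l, p j l = B l * u (j - 2 * l) := by
    intro j l
    refine sub_eq_zero.1 (eq_zero_of_int_recurrence e (a + 2) d
      (fun j l => p j l - B l * u (j - 2 * l)) ?_ ?_ ?_ ?_ j l)
    · intro j l hj
      by_cases hl : l < 0
      · simp [hpneg j l hj, hBneg l hl]
      · simp [hpneg j l hj, huneg (j - 2 * l) (by omega)]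
    · intro j l hl
      simp [hBd l hl, show p j l = 0 from hld _ _ _ hl]
    · intro l
      rcases lt_trichotomy l 0 with h | rfl | h
      · simp [hp0 l h.ne, hBneg l h]
      · simp [hp00, hB0, hu0]
      · simp [hp0 l h.ne', huneg (-(2 * l)) (by omega)]
    · intro j l
      have hR := hu (j - 2 * l)
      rw [show j - 2 - 2 * (l - 1) = j - 2 * l by ring, show j - 2 - 2 * l = j - 2 * l - 2 by ring,
        show j - 2 * (l + 1) = j - 2 * l - 2 by ring, show j - 1 - 2 * l = j - 2 * l - 1 by ring]
      have h0 := L0 j l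
      push_cast at h0 hR ⊢
      linear_combination h0 - B l * hR - u (j - 2 * l - 2) * hBrec l - 2 * u (j - 2 * l) * hBrec' l
  have hup : ∀ j, u j = p j 0 := fun j => by simp [hpu, hB0]
  have huN : ∀ j, N < j → u j = 0 := fun j hj => by rw [hup]; exact hN _ _ _ hj
  obtain ⟨φ, hφ⟩ := Polynomial.exists_coeff_eq_of_int u N huN
  have hφeq : (1 - Polynomial.X ^ 2) * Polynomial.derivative φ =
      (Polynomial.C e - Polynomial.C ((a : k) - d) * Polynomial.X) * φ := by
    refine sub_eq_zero.1 (Polynomial.ext fun n => ?_)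
    have hR := hu (n + 1)
    rw [show (n : ℤ) + 1 - 2 = n - 1 by ring, show (n : ℤ) + 1 - 1 = n by ring] at hR
    rw [Polynomial.coeff_one_sub_sq_mul_derivative_sub hφ huneg, Polynomial.coeff_zero]
    push_cast at hR ⊢
    linear_combination hR
  have hφ0 : φ.coeff 0 = 1 := by simpa [hu0] using hφ 0
  obtain ⟨m, hm⟩ := Polynomial.exists_sub_eq_two_mul_of_derivative_eq
    (fun h => by simp [h] at hφ0) hφeq
  have heint : e = ((a - d - 2 * m : ℤ) : k) := by
    push_cast
    linear_combination -hm
  have hκint : ∀ z : ℤ, κ (z : k) = 0 := fun z => by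
    rw [← zsmul_one, map_zsmul, Derivation.map_one_eq_zero, smul_zero]
  have hκd : κ (d : k) = 0 := by simp
  have hκu : ∀ j, κ (u j) = 0 := by
    have aux : ∀ n : ℕ, ∀ j : ℤ, j ≤ n → κ (u j) = 0 := by
      intro n
      induction n with
      | zero =>
        intro j hj
        rcases lt_or_eq_of_le hj with h | h
        · rw [huneg j h, map_zero]
        · rw [show j = 0 by simpa using h, hu0, Derivation.map_one_eq_zero]
      | succ n ih =>
        intro j hj
        by_cases hjn : j ≤ n
        · exact ih j hjn
        have hj0 : (j : k) ≠ 0 := by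
          have : j ≠ 0 := by omega
          exact_mod_cast this
        have hR := congrArg κ (hu j)
        rw [heint] at hR
        simp only [map_sub, map_add, Derivation.leibniz, hκint, ih (j - 2) (by omega),
          ih (j - 1) (by omega), map_zero, add_zero, smul_eq_mul, hκd,
          show κ (2 : k) = 0 by simpa using hκint 2] at hR
        exact (mul_eq_zero.1 (by linear_combination hR)).resolve_left hj0
    exact fun j => aux j.toNat j (by omega)
  have hκp : ∀ j l, κ (p j l) = 0 := fun j l => by
    obtain ⟨z, hz⟩ := hBz l
    rw [hpu, Derivation.leibniz, hκu, hz, hκint, smul_zero, smul_zero, add_zero]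
  obtain ⟨lam', hlam⟩ : ∃ lam' : k, (d : k) * lam' = lam := by
    rcases Nat.eq_zero_or_pos d with h | h
    · refine ⟨0, ?_⟩
      rw [← hn1, hld _ _ _ (by omega), mul_zero]
    · have : (d : k) ≠ 0 := by exact_mod_cast h.ne'
      exact ⟨lam / d, by field_simp⟩
  obtain ⟨h, hhneg, hh0, hh⟩ := exists_int_recurrence (k := k) e (a - d + 1)
    (c 0 (a - 1) 0 - (1 - lam') * d)
    (fun j => α * (j - 1 - (a - d)) * u (j - 1) - j * u j) (fun j hj => by
      rcases lt_or_eq_of_le hj with h | rfl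
      · rw [huneg _ h, huneg _ (by omega)]; ring
      · rw [huneg (0 - 1) (by omega)]; simp)
  have hqu : ∀ j l : ℤ, q j l = B l * (h (j - 2 * l) + (1 - lam') * (d - l) * u (j - 2 * l)
      + α * l * u (j - 2 * l + 1) - lam' * l * u (j - 2 * l + 2)) := by
    intro j l
    refine sub_eq_zero.1 (eq_zero_of_int_recurrence e (a + 1) d
      (fun j l => q j l - B l * (h (j - 2 * l) + (1 - lam') * (d - l) * u (j - 2 * l)
      + α * l * u (j - 2 * l + 1) - lam' * l * u (j - 2 * l + 2))) ?_ ?_ ?_ ?_ j l)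
    · intro j l hj
      rcases lt_trichotomy l 0 with hl | rfl | hl
      · simp [hqneg j l hj, hBneg l hl]
      · simp [hqneg j 0 hj, huneg j hj, hhneg j hj]
      · simp [hqneg j l hj, huneg (j - 2 * l) (by omega), huneg (j - 2 * l + 1) (by omega),
          huneg (j - 2 * l + 2) (by omega), hhneg (j - 2 * l) (by omega)]
    · intro j l hl
      simp [hBd l hl, show q j l = 0 from hld _ _ _ hl]
    · intro l
      rcases lt_trichotomy l 0 with hl | rfl | hl
      · simp [hq0 l hl.ne (by omega), hBneg l hl]
      · simp [hq00, hB0, hu0, hh0]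
      · by_cases hl1 : l = 1
        · have hb := hBrec 0
          subst hl1
          rw [hq01, huneg _ (by omega), huneg _ (by omega), hhneg _ (by omega),
            show (0 - 2 * 1 + 2 : ℤ) = 0 by norm_num, hu0]
          rw [hB0, zero_add] at hb
          push_cast at hb ⊢
          linear_combination lam' * hb - hlam
        · rw [hq0 l (by omega) hl1, huneg _ (by omega), huneg _ (by omega), huneg _ (by omega),
            hhneg _ (by omega)]
          ring
    · intro j l
      have hR0 := hu (j - 2 * l)
      have hR1 := hu (j - 2 * l + 1)
      have hR2 := hu (j - 2 * l + 2)
      have hH := hh (j - 2 * l)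
      have h1 := L1 j l
      rw [hκp, hpu, hpu, hpu, show j - 1 - 2 * (l - 1) = j - 2 * l + 1 by ring,
        show j - 1 - 2 * l = j - 2 * l - 1 by ring] at h1
      rw [show j - 2 * l + 1 - 2 = j - 2 * l - 1 by ring,
        show j - 2 * l + 1 - 1 = j - 2 * l by ring] at hR1
      rw [show j - 2 * l + 2 - 2 = j - 2 * l by ring,
        show j - 2 * l + 2 - 1 = j - 2 * l + 1 by ring] at hR2
      rw [show j - 2 - 2 * (l - 1) = j - 2 * l by ring, show j - 2 - 2 * l = j - 2 * l - 2 by ring,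
        show j - 2 * (l + 1) = j - 2 * l - 2 by ring, show j - 1 - 2 * l = j - 2 * l - 1 by ring]
      rw [show j - 2 * l - 2 + 1 = j - 2 * l - 1 by ring,
        show j - 2 * l - 2 + 2 = j - 2 * l by ring,
        show j - 2 * l - 1 + 1 = j - 2 * l by ring,
        show j - 2 * l - 1 + 2 = j - 2 * l + 1 by ring]
      have hb := hBrec l
      have hb' := hBrec' l
      push_cast at h1 hR0 hR1 hR2 hH hb hb' ⊢
      linear_combination h1 - (h (j - 2 * l - 2) + (1 - lam') * (d - l - 1) * u (j - 2 * l - 2)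
        + α * (l + 1) * u (j - 2 * l - 1) - lam' * (l + 1) * u (j - 2 * l)) * hb
        - (2 * (h (j - 2 * l) + (1 - lam') * (d - l + 1) * u (j - 2 * l)
        + α * (l - 1) * u (j - 2 * l + 1) - lam' * (l - 1) * u (j - 2 * l + 2))
        + α * u (j - 2 * l + 1)) * hb'
        - B l * ((1 - lam') * (d - l) * hR0 + α * l * hR1 - lam' * l * hR2 + hH)
        - B l * u (j - 2 * l) * hlam
  have hhN : ∀ j, N < j → h j = 0 := fun j hj => by
    have h1 := hqu j 0
    rw [show q j 0 = 0 from hN _ _ _ hj, hB0, mul_zero, sub_zero, huN j hj] at h1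
    push_cast at h1
    linear_combination -h1
  obtain ⟨ψ, hψ⟩ := Polynomial.exists_coeff_eq_of_int h N hhN
  have hψeq : (1 - Polynomial.X ^ 2) * Polynomial.derivative ψ =
      (Polynomial.C e - Polynomial.C ((a : k) - d - 1) * Polynomial.X) * ψ
      - (Polynomial.C ((a - d) * α) * φ
        + (1 - Polynomial.C α * Polynomial.X) * Polynomial.derivative φ) := by
    have key : (1 - Polynomial.X ^ 2) * Polynomial.derivative ψ -
        (Polynomial.C e - Polynomial.C ((a : k) - d - 1) * Polynomial.X) * ψ =
        Polynomial.C α * (Polynomial.X ^ 1 * Polynomial.derivative φ)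
        - Polynomial.C ((a - d) * α) * φ - Polynomial.derivative φ := by
      ext n
      rw [Polynomial.coeff_one_sub_sq_mul_derivative_sub hψ hhneg]
      simp only [Polynomial.coeff_sub, Polynomial.coeff_C_mul, Polynomial.coeff_X_pow_mul',
        Polynomial.coeff_derivative, hφ]
      have hH := hh (n + 1)
      rw [show (n : ℤ) + 1 - 2 = n - 1 by ring, show (n : ℤ) + 1 - 1 = n by ring] at hH
      rcases n with _ | n
      · simp at hH ⊢
        linear_combination hH
      · simp at hH ⊢
        linear_combination hH
    linear_combination key
  have hΨeq : (1 - Polynomial.X ^ 2) * Polynomial.derivative ((1 - Polynomial.X ^ 2) * ψ -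
      φ * (Polynomial.C (a - d + e * α) - Polynomial.C ((a - d) * α + e) * Polynomial.X)) =
      (Polynomial.C e - Polynomial.C ((a : k) - d + 1) * Polynomial.X) *
      ((1 - Polynomial.X ^ 2) * ψ -
      φ * (Polynomial.C (a - d + e * α) - Polynomial.C ((a - d) * α + e) * Polynomial.X)) := by
    simp only [Polynomial.derivative_mul, Polynomial.derivative_sub, Polynomial.derivative_X,
      Polynomial.derivative_C, Polynomial.derivative_one, Polynomial.derivative_X_sq]
    simp only [map_add, map_sub, map_mul, map_one, map_ofNat] at hψeq hφeq ⊢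
    linear_combination (1 - Polynomial.X ^ 2) * hψeq - (Polynomial.C (a : k) - Polynomial.C (d : k)
      + Polynomial.C e * Polynomial.C α - ((Polynomial.C (a : k) - Polynomial.C (d : k)) *
        Polynomial.C α + Polynomial.C e) * Polynomial.X + 1 - Polynomial.C α * Polynomial.X) * hφeq
  have hΨ : (1 - Polynomial.X ^ 2) * ψ -
      φ * (Polynomial.C (a - d + e * α) - Polynomial.C ((a - d) * α + e) * Polynomial.X) = 0 := by
    by_contra hne
    obtain ⟨m', hm'⟩ := Polynomial.exists_sub_eq_two_mul_of_derivative_eq hne hΨeq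
    have : ((2 * m + 1 : ℕ) : k) = (2 * m' : ℕ) := by
      push_cast
      linear_combination hm' - hm
    have := Nat.cast_injective this
    omega
  have h0 := congrArg (Polynomial.eval 0) hΨ
  have hψ0 : ψ.eval 0 = h 0 := by simpa [Polynomial.coeff_zero_eq_eval_zero] using hψ 0
  have hφ1 : φ.eval 0 = 1 := by simpa [Polynomial.coeff_zero_eq_eval_zero] using hφ0
  simp [hψ0, hφ1, hh0] at h0
  refine ⟨a - d - 2 * m, ?_⟩
  rw [← heint]
  linear_combination h0 - hlam

theorem edge_value_of_scaling {k : Type*} [Field k] [CharZero k] (κ : Derivation ℤ k k)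
    (s α f₁ f₂ g g' lam : k) (hs : s ≠ 0) (hκs : κ s = s) (d : ℕ) (a : ℤ)
    (c : ℤ → ℤ → ℤ → k) (N : ℤ)
    (hl0 : ∀ j i l, l < 0 → c j i l = 0) (hld : ∀ j i l, (d : ℤ) < l → c j i l = 0)
    (hN : ∀ j i l, N < j → c j i l = 0) (ha : ∀ j i l, a < i → c j i l = 0)
    (haj : ∀ j l, j ≠ 0 → c j a l = 0) (h1 : c 0 a 0 = 1)
    (hrec : ∀ j i l : ℤ, κ (c j i l) + j * c j (i - 1) l
      + (i + 1) * (s ^ 2 * c (j - 2) (i + 1) l + α * s * c (j - 1) (i + 1) l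
        + f₁ * c (j + 1) (i + 1) l + f₂ * c (j + 2) (i + 1) l)
      + (l + 1) * c j i (l + 1)
      + (d - l + 1) * (2 * s ^ 2 * c (j - 2) i (l - 1) + α * s * c (j - 1) i (l - 1)
        - f₁ * c (j + 1) i (l - 1) - 2 * f₂ * c (j + 2) i (l - 1))
      = g * c (j - 1) i l + lam * c j i l + g' * c (j + 1) i l) :
    ∃ m : ℤ, c 0 (a - 1) 0 = a + m * α - lam := by
  obtain ⟨m, hm⟩ := edge_value κ α (f₁ * s) (f₂ * s ^ 2) (g / s) (g' * s) lam d a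
    (fun j i l => s ^ (-j) * c j i l) N
    (fun j i l h => by simp [hl0 j i l h]) (fun j i l h => by simp [hld j i l h])
    (fun j i l h => by simp [hN j i l h]) (fun j i l h => by simp [ha j i l h])
    (fun j l h => by simp [haj j l h]) (by simpa using h1) (fun j i l => by
      have hr := hrec j i l
      have hκ : κ (s ^ (-j)) = -j * s ^ (-j) := by
        rw [Derivation.leibniz_zpow, hκs, zpow_sub_one₀ hs]
        simp only [smul_eq_mul, zsmul_eq_mul]
        push_cast
        field_simp
      have e1 : s ^ (-(j - 1)) = s ^ (-j) * s := by
        rw [show -(j - 1) = -j + 1 by ring, zpow_add_one₀ hs]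
      have e2 : s ^ (-(j - 2)) = s ^ (-j) * s ^ 2 := by
        rw [show -(j - 2) = -j + 2 by ring, zpow_add₀ hs]; norm_cast
      have e3 : s ^ (-j) = s ^ (-(j + 1)) * s := by
        rw [← zpow_add_one₀ hs]; congr 1; ring
      have e4 : s ^ (-j) = s ^ (-(j + 2)) * s ^ 2 := by
        rw [show -j = -(j + 2) + 2 by ring, zpow_add₀ hs]; norm_cast
      have eg : g / s * s = g := by field_simp
      rw [Derivation.leibniz, hκ, smul_eq_mul, smul_eq_mul, e1, e2]
      linear_combination (s ^ (-j)) * hr - s ^ (-j) * c (j - 1) i l * eg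
        - ((i + 1) * f₁ * c (j + 1) (i + 1) l - (d - l + 1) * f₁ * c (j + 1) i (l - 1)
          - g' * c (j + 1) i l) * e3
        - ((i + 1) * f₂ * c (j + 2) (i + 1) l - 2 * (d - l + 1) * f₂ * c (j + 2) i (l - 1)) * e4)
  exact ⟨m, by simpa using hm⟩

theorem slice_degree_zero_of_normalized {k : Type*} [Field k] [CharZero k] (κ : Derivation ℤ k k)
    (s r α β g g' lam : k) (hs : s ≠ 0) (hr : r ≠ 0) (hκs : κ s = s) (hκr : κ r = r)
    (hα : κ α = 0) (hβ : κ β = 0)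
    (hgen : ∀ (a : ℕ) (m m' : ℤ), 2 * (a : k) + m * α + m' * β = 0 → a = 0)
    (d : ℕ) (a : ℤ) (c : ℤ → ℤ → ℤ → k) (N : ℤ)
    (hi0 : ∀ j i l, i < 0 → c j i l = 0)
    (hl0 : ∀ j i l, l < 0 → c j i l = 0) (hld : ∀ j i l, (d : ℤ) < l → c j i l = 0)
    (hN : ∀ j i l, N < |j| → c j i l = 0) (ha : ∀ j i l, a < i → c j i l = 0)
    (haj : ∀ j l, j ≠ 0 → c j a l = 0) (h1 : c 0 a 0 = 1)
    (hrec : ∀ j i l : ℤ, κ (c j i l) + j * c j (i - 1) l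
      + (i + 1) * (s ^ 2 * c (j - 2) (i + 1) l + α * s * c (j - 1) (i + 1) l
        - β * r * c (j + 1) (i + 1) l - r ^ 2 * c (j + 2) (i + 1) l)
      + (l + 1) * c j i (l + 1)
      + (d - l + 1) * (2 * s ^ 2 * c (j - 2) i (l - 1) + α * s * c (j - 1) i (l - 1)
        + β * r * c (j + 1) i (l - 1) + 2 * r ^ 2 * c (j + 2) i (l - 1))
      = g * c (j - 1) i l + lam * c j i l + g' * c (j + 1) i l) :
    a = 0 ∧ d = 0 := by
  obtain ⟨m, hm⟩ := edge_value_of_scaling κ s α (-β * r) (-r ^ 2) g g' lam hs hκs d a c N hl0 hld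
    (fun j i l h => hN j i l (h.trans_le (le_abs_self j))) ha haj h1
    (fun j i l => by linear_combination hrec j i l)
  have hsgn : ∀ z : ℤ, ((-1 : k) ^ z) * (-1) ^ z = 1 := fun z => by
    rw [← mul_zpow]; simp
  have hκsgn : ∀ (z : ℤ) (x : k), κ ((-1) ^ z * x) = (-1) ^ z * κ x := fun z x => by
    rcases Int.even_or_odd z with h | h
    · simp [h.neg_one_zpow]
    · simp [h.neg_one_zpow]
  obtain ⟨m', hm'⟩ := edge_value_of_scaling κ r β (-α * s) (-s ^ 2) g' g lam hr hκr d a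
    (fun j i l => (-1) ^ (i + a) * c (-j) i l) N
    (fun j i l h => by simp [hl0 _ i l h]) (fun j i l h => by simp [hld _ i l h])
    (fun j i l h => by
      simp [hN (-j) i l (h.trans_le (by rw [abs_neg]; exact le_abs_self j))])
    (fun j i l h => by simp [ha _ i l h])
    (fun j l h => by simp [haj (-j) l (by omega)])
    (by
      rw [neg_zero, h1, (Even.neg_one_zpow ⟨a, rfl⟩), mul_one])
    (fun j i l => by
      have hrn := hrec (-j) i l
      have e1 : (-1 : k) ^ (i - 1 + a) = -(-1) ^ (i + a) := by
        rw [show i - 1 + a = i + a - 1 by ring, zpow_sub_one₀ (by norm_num)]; norm_num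
      have e2 : (-1 : k) ^ (i + 1 + a) = -(-1) ^ (i + a) := by
        rw [show i + 1 + a = i + a + 1 by ring, zpow_add_one₀ (by norm_num)]; norm_num
      rw [hκsgn, e1, e2, show -(j - 2) = -j + 2 by ring, show -(j - 1) = -j + 1 by ring,
        show -(j + 2) = -j - 2 by ring, show -(j + 1) = -j - 1 by ring]
      push_cast at hrn
      linear_combination ((-1) ^ (i + a)) * hrn)
  have hsg1 : (-1 : k) ^ (a - 1 + a) = -1 := by
    apply Odd.neg_one_zpow
    exact ⟨a - 1, by ring⟩
  rw [neg_zero, hsg1] at hm'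
  have hsum : 2 * (a - lam) + m * α + m' * β = 0 := by linear_combination -hm - hm'
  have hκint : ∀ z : ℤ, κ (z : k) = 0 := fun z => by
    rw [← zsmul_one, map_zsmul, Derivation.map_one_eq_zero, smul_zero]
  have hκ2 : κ (2 : k) = 0 := by simpa using hκint 2
  have hκlam : κ lam = 0 := by
    have h := congrArg κ hsum
    simp only [map_add, Derivation.leibniz, map_sub, hκint, hα, hβ, hκ2, map_zero,
      add_zero, smul_eq_mul, mul_zero] at h
    have h2 : (2 : k) ≠ 0 := two_ne_zero
    have : (2 : k) * κ lam = 0 := by linear_combination -h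
    exact (mul_eq_zero.1 this).resolve_left h2
  have hn : ∀ l : ℤ, κ (c 0 a l) + (l + 1) * c 0 a (l + 1) = lam * c 0 a l := by
    intro l
    have h := hrec 0 a l
    rw [ha _ (a + 1) l (by omega), ha _ (a + 1) l (by omega), ha _ (a + 1) l (by omega),
      ha _ (a + 1) l (by omega), haj (0 - 2) _ (by omega), haj (0 - 1) _ (by omega),
      haj (0 + 1) _ (by omega), haj (0 + 2) _ (by omega), haj (0 - 1) _ (by omega),
      haj (0 + 1) _ (by omega)] at h
    push_cast at h
    linear_combination h
  have hpow : ∀ n : ℕ, κ (c 0 a n) = 0 ∧ (n.factorial : k) * c 0 a n = lam ^ n := by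
    intro n
    induction n with
    | zero => simp [h1]
    | succ n ih =>
      have h := hn n
      have hne : (n + 1 : k) ≠ 0 := by exact_mod_cast Nat.succ_ne_zero n
      rw [ih.1, zero_add] at h
      push_cast at h ⊢
      constructor
      · have h' := congrArg κ h
        have hκn : κ (n : k) = 0 := by simp
        simp only [Derivation.leibniz, map_add, hκn, Derivation.map_one_eq_zero, hκlam, ih.1,
          add_zero, smul_eq_mul] at h'
        exact (mul_eq_zero.1 (by linear_combination h')).resolve_left hne
      · rw [Nat.factorial_succ, pow_succ, ← ih.2]
        push_cast
        linear_combination (n.factorial : k) * h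
  have hlam : lam = 0 := by
    have h := (hpow (d + 1)).2
    rw [hld _ _ _ (by push_cast; omega), mul_zero] at h
    exact pow_eq_zero_iff (Nat.succ_ne_zero d) |>.1 h.symm
  have ha0 : 0 ≤ a := by
    by_contra h
    rw [hi0 _ _ _ (by omega)] at h1
    exact zero_ne_one h1
  obtain ⟨n, rfl⟩ := Int.eq_ofNat_of_zero_le ha0
  have hn0 : n = 0 := hgen n m m' (by
    rw [hlam] at hsum
    push_cast at hsum
    linear_combination hsum)
  subst hn0
  refine ⟨rfl, ?_⟩
  have h := hrec 2 0 1
  have hz : ∀ j l, j ≠ 0 → c j 0 l = 0 := haj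
  rw [hz 2 1 (by norm_num), hz _ (1 + 1) (by norm_num), hz (2 - 1) 1 (by norm_num),
    hz (2 + 1) 1 (by norm_num), hz (2 - 1) _ (by norm_num), hz (2 + 1) _ (by norm_num),
    hz (2 + 2) _ (by norm_num), hi0 _ (0 - 1) _ (by norm_num), ha _ (0 + 1) _ (by norm_num),
    ha _ (0 + 1) _ (by norm_num), ha _ (0 + 1) _ (by norm_num), ha _ (0 + 1) _ (by norm_num),
    show c (2 - 2) 0 (1 - 1) = 1 from h1, map_zero] at h
  push_cast at h
  have h' : (d : k) * (2 * s ^ 2) = 0 := by linear_combination h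
  have : (d : k) = 0 := (mul_eq_zero.1 h').resolve_right (mul_ne_zero two_ne_zero (pow_ne_zero 2 hs))
  exact_mod_cast this

theorem slice_support {k : Type*} [Field k] [CharZero k] (κ : Derivation ℤ k k)
    (s r α β g g' lam K₀ : k) (hs : s ≠ 0) (hr : r ≠ 0) (hκs : κ s = s) (hκr : κ r = r)
    (hα : κ α = 0) (hβ : κ β = 0)
    (hgen : ∀ (a : ℕ) (m m' : ℤ), 2 * (a : k) + m * α + m' * β = 0 → a = 0)
    (d : ℕ) (c : ℤ → ℤ → ℤ → k) (N : ℤ) (hc : ∃ j i l, c j i l ≠ 0)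
    (hi0 : ∀ j i l, i < 0 → c j i l = 0)
    (hl0 : ∀ j i l, l < 0 → c j i l = 0) (hld : ∀ j i l, (d : ℤ) < l → c j i l = 0)
    (hN : ∀ j i l, N < |j| → c j i l = 0) (hNi : ∀ j i l, N < i → c j i l = 0)
    (hrec : ∀ j i l : ℤ, κ (c j i l) + j * c j (i - 1) l
      + (i + 1) * (s ^ 2 * c (j - 2) (i + 1) l + α * s * c (j - 1) (i + 1) l
        - β * r * c (j + 1) (i + 1) l - r ^ 2 * c (j + 2) (i + 1) l)
      + (l + 1) * c j i (l + 1)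
      + (d - l + 1) * (2 * s ^ 2 * c (j - 2) i (l - 1) + α * s * c (j - 1) i (l - 1)
        + β * r * c (j + 1) i (l - 1) + 2 * r ^ 2 * c (j + 2) i (l - 1))
      = K₀ * c j (i - 1) l + g * c (j - 1) i l + lam * c j i l + g' * c (j + 1) i l) :
    d = 0 ∧ ∃ j₀, ∀ j i l, c j i l ≠ 0 → j = j₀ ∧ i = 0 ∧ l = 0 := by
  obtain ⟨j₁, i₁, l₁, h₁⟩ := hc
  obtain ⟨a, ⟨j₀, l₀, hne⟩, hmax⟩ := Int.exists_greatest_of_bdd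
    (P := fun i => ∃ j l, c j i l ≠ 0) ⟨N, by
      rintro z ⟨j, l, h⟩
      by_contra h'
      exact h (hNi _ _ _ (by omega))⟩ ⟨i₁, j₁, l₁, h₁⟩
  have ha : ∀ j i l, a < i → c j i l = 0 := by
    intro j i l h
    by_contra h'
    have := hmax _ ⟨j, l, h'⟩
    omega
  have hK : ∀ j l : ℤ, ((j : k) - K₀) * c j a l = 0 := by
    intro j l
    have h := hrec j (a + 1) l
    simp only [ha _ (a + 1 + 1) _ (by omega), ha _ (a + 1) _ (by omega), map_zero,
      show a + 1 - 1 = a by ring] at h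
    linear_combination h
  have hK₀ : (j₀ : k) = K₀ := sub_eq_zero.1 ((mul_eq_zero.1 (hK j₀ l₀)).resolve_right hne)
  have haj : ∀ j l, j ≠ j₀ → c j a l = 0 := by
    intro j l h
    refine (mul_eq_zero.1 (hK j l)).resolve_left ?_
    rw [← hK₀, sub_eq_zero]
    exact_mod_cast h
  have hn : ∀ l : ℤ, κ (c j₀ a l) + (l + 1) * c j₀ a (l + 1) = lam * c j₀ a l := by
    intro l
    have h := hrec j₀ a l
    rw [ha _ (a + 1) l (by omega), ha _ (a + 1) l (by omega), ha _ (a + 1) l (by omega),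
      ha _ (a + 1) l (by omega), haj (j₀ - 2) _ (by omega), haj (j₀ - 1) _ (by omega),
      haj (j₀ + 1) _ (by omega), haj (j₀ + 2) _ (by omega), haj (j₀ - 1) _ (by omega),
      haj (j₀ + 1) _ (by omega), hK₀] at h
    linear_combination h
  have hc0 : c j₀ a 0 ≠ 0 := by
    intro h0
    have hz : ∀ n : ℕ, c j₀ a n = 0 := by
      intro n
      induction n with
      | zero => exact h0
      | succ n ih =>
        have h := hn n
        have hne : (n + 1 : k) ≠ 0 := by exact_mod_cast Nat.succ_ne_zero n
        rw [ih] at h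
        push_cast at h ⊢
        rw [map_zero, zero_add, mul_zero] at h
        exact (mul_eq_zero.1 h).resolve_left hne
    rcases lt_or_ge l₀ 0 with h | h
    · exact hne (hl0 _ _ _ h)
    · obtain ⟨n, rfl⟩ := Int.eq_ofNat_of_zero_le h
      exact hne (hz n)
  set n₀ := c j₀ a 0 with hn₀
  obtain ⟨ha0, hd0⟩ := slice_degree_zero_of_normalized κ s r α β g g' (lam - κ n₀ / n₀) hs hr hκs hκr
    hα hβ hgen d a (fun j i l => c (j + j₀) i l / n₀) (N + |j₀|)
    (fun j i l h => by simp [hi0 _ i l h]) (fun j i l h => by simp [hl0 _ i l h])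
    (fun j i l h => by simp [hld _ i l h])
    (fun j i l h => by
      have : |j| ≤ |j + j₀| + |j₀| := by simpa using abs_sub (j + j₀) j₀
      simp [hN (j + j₀) i l (by omega)])
    (fun j i l h => by simp [ha _ i l h]) (fun j l h => by simp [haj (j + j₀) l (by omega)])
    (by simp [← hn₀, hc0]) (fun j i l => by
      have h := hrec (j + j₀) i l
      have hk : κ (c (j + j₀) i l / n₀) =
          κ (c (j + j₀) i l) / n₀ - c (j + j₀) i l / n₀ * (κ n₀ / n₀) := by
        rw [Derivation.leibniz_div]
        simp only [smul_eq_mul]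
        field_simp
      rw [← hK₀] at h
      push_cast at h
      rw [hk, show j - 2 + j₀ = j + j₀ - 2 by ring, show j - 1 + j₀ = j + j₀ - 1 by ring,
        show j + 2 + j₀ = j + j₀ + 2 by ring, show j + 1 + j₀ = j + j₀ + 1 by ring]
      linear_combination h / n₀)
  subst ha0
  refine ⟨hd0, j₀, fun j i l h => ?_⟩
  have hl : l = 0 := by
    by_contra h'
    rcases lt_or_gt_of_ne h' with h' | h'
    · exact h (hl0 _ _ _ h')
    · exact h (hld _ _ _ (by omega))
  have hi : i = 0 := by
    by_contra h'
    rcases lt_or_gt_of_ne h' with h' | h'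
    · exact h (hi0 _ _ _ h')
    · exact h (ha _ _ _ h')
  subst hi
  refine ⟨?_, rfl, hl⟩
  by_contra h'
  exact h (haj _ _ h')

namespace MvPolynomial

theorem coeff_sum_monomial_map {k σ : Type*} [CommSemiring k] (κ : k →+ k) (A : MvPolynomial σ k)
    (n : σ →₀ ℕ) : coeff n (∑ m ∈ A.support, monomial m (κ (coeff m A))) = κ (coeff n A) := by
  classical
  rw [coeff_sum]
  simp only [coeff_monomial, Finset.sum_ite_eq', mem_support_iff]
  split_ifs with h
  · rfl
  · rw [not_not.1 h, map_zero]

/-- The derivation acting on coefficients. -/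
noncomputable def coeffDeriv {k σ : Type*} [Field k] (κ : Derivation ℤ k k) :
    Derivation ℤ (MvPolynomial σ k) (MvPolynomial σ k) :=
  Derivation.mk' (AddMonoidHom.toIntLinearMap
    { toFun := fun A => ∑ m ∈ A.support, monomial m ((κ : k →+ k) (A.coeff m))
      map_zero' := by simp
      map_add' := fun A B => by
        ext n
        rw [coeff_add, coeff_sum_monomial_map, coeff_sum_monomial_map, coeff_sum_monomial_map,
          coeff_add, map_add] })
    (fun A B => by
      classical
      ext n
      change coeff n (∑ m ∈ (A * B).support, monomial m ((κ : k →+ k) (coeff m (A * B)))) =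
        coeff n (A * (∑ m ∈ B.support, monomial m ((κ : k →+ k) (coeff m B))) +
          B * (∑ m ∈ A.support, monomial m ((κ : k →+ k) (coeff m A))))
      rw [coeff_sum_monomial_map, coeff_add, mul_comm B]
      simp only [coeff_mul, coeff_sum_monomial_map, map_sum]
      simp only [AddMonoidHom.coe_coe, Derivation.leibniz, smul_eq_mul, Finset.sum_add_distrib]
      congr 1
      exact Finset.sum_congr rfl fun x _ => mul_comm _ _)

theorem coeff_coeffDeriv {k σ : Type*} [Field k] (κ : Derivation ℤ k k) (A : MvPolynomial σ k)
    (n : σ →₀ ℕ) : coeff n (coeffDeriv κ A) = κ (coeff n A) :=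
  coeff_sum_monomial_map (κ : k →+ k) A n

theorem coeffDeriv_C {k σ : Type*} [Field k] (κ : Derivation ℤ k k) (a : k) :
    coeffDeriv κ (C a : MvPolynomial σ k) = C (κ a) := by
  classical
  ext n
  rw [coeff_coeffDeriv, coeff_C, coeff_C]
  split_ifs <;> simp

theorem coeffDeriv_X {k σ : Type*} [Field k] (κ : Derivation ℤ k k) (i : σ) :
    coeffDeriv κ (X i : MvPolynomial σ k) = 0 := by
  classical
  ext n
  rw [coeff_coeffDeriv, coeff_X, coeff_zero]
  split_ifs <;> simp

/-- Coefficients indexed by integer vectors, extended by zero. -/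
noncomputable def intCoeff {k : Type*} [CommSemiring k] {n : ℕ} (A : MvPolynomial (Fin n) k)
    (v : Fin n → ℤ) : k :=
  open Classical in
  if ∀ i, 0 ≤ v i then coeff (Finsupp.equivFunOnFinite.symm fun i => (v i).toNat) A else 0

section intCoeff

variable {k : Type*} [CommSemiring k] {n : ℕ}

theorem intCoeff_eq_zero (A : MvPolynomial (Fin n) k) {v : Fin n → ℤ} {i : Fin n} (h : v i < 0) :
    A.intCoeff v = 0 :=
  if_neg fun h' => (h' i).not_gt h

theorem intCoeff_natCast (A : MvPolynomial (Fin n) k) (m : Fin n →₀ ℕ) :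
    A.intCoeff (fun i => (m i : ℤ)) = coeff m A := by
  rw [intCoeff, if_pos fun i => by positivity]
  congr 1
  ext i
  simp

theorem exists_intCoeff_eq (A : MvPolynomial (Fin n) k) {v : Fin n → ℤ} (h : A.intCoeff v ≠ 0) :
    ∃ m : Fin n →₀ ℕ, coeff m A ≠ 0 ∧ v = fun i => (m i : ℤ) := by
  by_cases hv : ∀ i, 0 ≤ v i
  · refine ⟨Finsupp.equivFunOnFinite.symm fun i => (v i).toNat, ?_, ?_⟩
    · rwa [intCoeff, if_pos hv] at h
    · ext i
      simp [hv i]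
  · exact absurd (if_neg hv) h

theorem intCoeff_add (A B : MvPolynomial (Fin n) k) (v : Fin n → ℤ) :
    (A + B).intCoeff v = A.intCoeff v + B.intCoeff v := by
  simp only [intCoeff]
  split_ifs <;> simp

theorem intCoeff_C_mul (a : k) (A : MvPolynomial (Fin n) k) (v : Fin n → ℤ) :
    (C a * A).intCoeff v = a * A.intCoeff v := by
  simp only [intCoeff]
  split_ifs <;> simp

theorem intCoeff_X_mul (A : MvPolynomial (Fin n) k) (i : Fin n) (v : Fin n → ℤ) :
    (X i * A).intCoeff v = A.intCoeff (v - Pi.single i 1) := by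
  by_cases hv : ∀ i, 0 ≤ v i
  · by_cases hi : 1 ≤ v i
    · have hv' : ∀ j, 0 ≤ (v - Pi.single i 1 : Fin n → ℤ) j := fun j => by
        rw [Pi.sub_apply, Pi.single_apply]
        split_ifs with h
        · subst h; omega
        · simpa using hv j
      rw [intCoeff, if_pos hv, intCoeff, if_pos hv']
      have : (Finsupp.equivFunOnFinite.symm fun j => (v j).toNat : Fin n →₀ ℕ) =
          Finsupp.single i 1 +
            Finsupp.equivFunOnFinite.symm fun j => ((v - Pi.single i 1 : Fin n → ℤ) j).toNat := by
        ext j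
        simp only [Finsupp.coe_add, Pi.add_apply, Finsupp.coe_equivFunOnFinite_symm,
          Finsupp.single_apply, Pi.sub_apply, Pi.single_apply]
        by_cases h : i = j
        · subst h; simp; omega
        · simp [h, Ne.symm h]
      rw [this, coeff_X_mul]
    · rw [intCoeff_eq_zero A (i := i) (by simp; omega), intCoeff, if_pos hv, coeff_X_mul', if_neg]
      have := hv i
      simp
      omega
  · push Not at hv
    obtain ⟨j, hj⟩ := hv
    have h1 : (v - Pi.single i 1 : Fin n → ℤ) j < 0 := by
      rw [Pi.sub_apply, Pi.single_apply]
      split_ifs <;> omega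
    rw [intCoeff_eq_zero _ hj, intCoeff_eq_zero _ h1]

end intCoeff

theorem intCoeff_pderiv {k : Type*} [CommRing k] {n : ℕ} (A : MvPolynomial (Fin n) k) (i : Fin n)
    (v : Fin n → ℤ) :
    (pderiv i A).intCoeff v = (v i + 1) * A.intCoeff (v + Pi.single i 1) := by
  by_cases hv : ∀ i, 0 ≤ v i
  · have hv' : ∀ j, 0 ≤ (v + Pi.single i 1 : Fin n → ℤ) j := fun j => by
      rw [Pi.add_apply, Pi.single_apply]
      have := hv j
      split_ifs <;> omega
    rw [intCoeff, if_pos hv, intCoeff, if_pos hv', coeff_pderiv, mul_comm]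
    congr 1
    · rw [Finsupp.coe_equivFunOnFinite_symm]
      congr 1
      have : (((v i).toNat : ℤ) : k) = (v i : k) := by rw [Int.toNat_of_nonneg (hv i)]
      rw [← this, Int.cast_natCast]
    · congr 1
      ext j
      simp only [Finsupp.coe_add, Pi.add_apply, Finsupp.coe_equivFunOnFinite_symm,
        Finsupp.single_apply, Pi.single_apply]
      have := hv j
      by_cases h : i = j
      · subst h; simp; omega
      · simp [h, Ne.symm h]
  · push Not at hv
    obtain ⟨j, hj⟩ := hv
    rw [intCoeff_eq_zero _ hj]
    by_cases h : j = i
    · subst h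
      by_cases h1 : v j = -1
      · rw [h1]; simp
      · rw [intCoeff_eq_zero A (i := j) (by simp; omega), mul_zero]
    · rw [intCoeff_eq_zero A (i := j) (by simp [h, hj]), mul_zero]

theorem intCoeff_coeffDeriv {k : Type*} [Field k] {n : ℕ} (κ : Derivation ℤ k k)
    (A : MvPolynomial (Fin n) k) (v : Fin n → ℤ) :
    (coeffDeriv κ A).intCoeff v = κ (A.intCoeff v) := by
  simp only [intCoeff]
  split_ifs
  · rw [coeff_coeffDeriv]
  · simp

/-- Multiplicativity of top weights: bounding the weight of a factor by that of the product. -/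
theorem weight_le_of_mul {k σ : Type*} [Field k] (wt : (σ →₀ ℕ) →+ ℤ) {H A : MvPolynomial σ k}
    {N r : ℤ} (hA : ∃ m, coeff m A ≠ 0 ∧ wt m = N) (hAN : ∀ m, coeff m A ≠ 0 → wt m ≤ N)
    (hHA : ∀ m, coeff m (H * A) ≠ 0 → wt m ≤ N + r) (m : σ →₀ ℕ) (hm : coeff m H ≠ 0) :
    wt m ≤ r := by
  classical
  obtain ⟨p, hp, hpmax⟩ := H.support.exists_max_image wt ⟨m, mem_support_iff.2 hm⟩
  refine (hpmax m (mem_support_iff.2 hm)).trans ?_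
  obtain ⟨q, hq, hqN⟩ := hA
  obtain ⟨u, hu, v, hv, huv⟩ := UniqueSums.uniqueAdd_of_nonempty
    (A := H.support.filter fun x => wt x = wt p) (B := A.support.filter fun x => wt x = N)
    ⟨p, by simpa using hp⟩ ⟨q, by simp [hq, hqN]⟩
  rw [Finset.mem_filter] at hu hv
  have hc : coeff (u + v) (H * A) = coeff u H * coeff v A := by
    rw [coeff_mul]
    refine Finset.sum_eq_single (u, v) (fun x hx hne => ?_) (fun h => ?_)
    · rw [Finset.HasAntidiagonal.mem_antidiagonal] at hx
      by_contra hxne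
      have h1 : coeff x.1 H ≠ 0 := left_ne_zero_of_mul hxne
      have h2 : coeff x.2 A ≠ 0 := right_ne_zero_of_mul hxne
      have h3 := hpmax x.1 (mem_support_iff.2 h1)
      have h4 := hAN x.2 h2
      have h5 := congrArg wt hx
      rw [map_add, map_add, hu.2, hv.2] at h5
      obtain ⟨h6, h7⟩ := huv (a := x.1) (b := x.2)
        (by rw [Finset.mem_filter]; exact ⟨mem_support_iff.2 h1, by omega⟩)
        (by rw [Finset.mem_filter]; exact ⟨mem_support_iff.2 h2, by omega⟩) hx
      exact hne (Prod.ext h6 h7)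
    · rw [Finset.HasAntidiagonal.mem_antidiagonal] at h
      exact absurd rfl h
  have := hHA (u + v) (by
    rw [hc]
    exact mul_ne_zero (mem_support_iff.1 hu.1) (mem_support_iff.1 hv.1))
  rw [map_add, hu.2, hv.2] at this
  omega

end MvPolynomial

namespace MvPolynomial

section Fin4

variable {k : Type*} [CommSemiring k]

theorem intCoeff_X_zero_pow_mul (A : MvPolynomial (Fin 4) k) (e : ℕ) (a b c d : ℤ) :
    (X 0 ^ e * A).intCoeff ![a, b, c, d] = A.intCoeff ![a - e, b, c, d] := by
  induction e generalizing a with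
  | zero => simp
  | succ e ih =>
    rw [pow_succ', mul_assoc, intCoeff_X_mul]
    have : ![a, b, c, d] - Pi.single 0 1 = ![a - 1, b, c, d] := by
      ext i; fin_cases i <;> simp
    rw [this, ih]
    congr 2
    push_cast
    ring

theorem intCoeff_X_one_mul (A : MvPolynomial (Fin 4) k) (a b c d : ℤ) :
    (X 1 * A).intCoeff ![a, b, c, d] = A.intCoeff ![a, b - 1, c, d] := by
  rw [intCoeff_X_mul]
  congr 1
  ext i; fin_cases i <;> simp

theorem intCoeff_X_two_mul (A : MvPolynomial (Fin 4) k) (a b c d : ℤ) :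
    (X 2 * A).intCoeff ![a, b, c, d] = A.intCoeff ![a, b, c - 1, d] := by
  rw [intCoeff_X_mul]
  congr 1
  ext i; fin_cases i <;> simp

theorem intCoeff_X_three_mul (A : MvPolynomial (Fin 4) k) (a b c d : ℤ) :
    (X 3 * A).intCoeff ![a, b, c, d] = A.intCoeff ![a, b, c, d - 1] := by
  rw [intCoeff_X_mul]
  congr 1
  ext i; fin_cases i <;> simp

end Fin4

section Fin4Ring

variable {k : Type*} [CommRing k] (A : MvPolynomial (Fin 4) k) (a b c d : ℤ)

theorem intCoeff_pderiv_zero :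
    (pderiv 0 A).intCoeff ![a, b, c, d] = (a + 1) * A.intCoeff ![a + 1, b, c, d] := by
  rw [intCoeff_pderiv]
  congr 2
  ext i; fin_cases i <;> simp

theorem intCoeff_pderiv_one :
    (pderiv 1 A).intCoeff ![a, b, c, d] = (b + 1) * A.intCoeff ![a, b + 1, c, d] := by
  rw [intCoeff_pderiv]
  congr 2
  ext i; fin_cases i <;> simp

theorem intCoeff_pderiv_two :
    (pderiv 2 A).intCoeff ![a, b, c, d] = (c + 1) * A.intCoeff ![a, b, c + 1, d] := by
  rw [intCoeff_pderiv]
  congr 2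
  ext i; fin_cases i <;> simp

theorem intCoeff_pderiv_three :
    (pderiv 3 A).intCoeff ![a, b, c, d] = (d + 1) * A.intCoeff ![a, b, c, d + 1] := by
  rw [intCoeff_pderiv]
  congr 2
  ext i; fin_cases i <;> simp

end Fin4Ring

end MvPolynomial

section

open MvPolynomial

/-- The derivation `y² ∂` on polynomials in `y, z, ξ, η`, where `∂ y = y z`, `∂ z = f y`,
`∂ ξ = η`, `∂ η = y f' y ξ` and `f y = f₂ y² + f₁ y + f₋₁ y⁻¹ + f₋₂ y⁻²`. -/
noncomputable def variationalDeriv {k : Type*} [Field k] (κ : Derivation ℤ k k)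
    (f₂ f₁ e₁ e₂ : k) : Derivation ℤ (MvPolynomial (Fin 4) k) (MvPolynomial (Fin 4) k) :=
  (X 0 ^ 2 : MvPolynomial (Fin 4) k) • coeffDeriv κ
    + (X 0 ^ 3 * X 1 : MvPolynomial (Fin 4) k) • (pderiv 0).restrictScalars ℤ
    + (C f₂ * X 0 ^ 4 + C f₁ * X 0 ^ 3 + C e₁ * X 0 + C e₂ : MvPolynomial (Fin 4) k) •
        (pderiv 1).restrictScalars ℤ
    + (X 0 ^ 2 * X 3 : MvPolynomial (Fin 4) k) • (pderiv 2).restrictScalars ℤ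
    + ((C (2 * f₂) * X 0 ^ 4 + C f₁ * X 0 ^ 3 + C (-e₁) * X 0 + C (-2 * e₂)) * X 2 :
        MvPolynomial (Fin 4) k) • (pderiv 3).restrictScalars ℤ

variable {k : Type*} [Field k] (κ : Derivation ℤ k k) (f₂ f₁ e₁ e₂ : k)

theorem variationalDeriv_apply (A : MvPolynomial (Fin 4) k) :
    variationalDeriv κ f₂ f₁ e₁ e₂ A = X 0 ^ 2 * coeffDeriv κ A + X 0 ^ 3 * X 1 * pderiv 0 A
      + (C f₂ * X 0 ^ 4 + C f₁ * X 0 ^ 3 + C e₁ * X 0 + C e₂) * pderiv 1 A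
      + X 0 ^ 2 * X 3 * pderiv 2 A
      + (C (2 * f₂) * X 0 ^ 4 + C f₁ * X 0 ^ 3 + C (-e₁) * X 0 + C (-2 * e₂)) * X 2
        * pderiv 3 A := rfl

theorem intCoeff_variationalDeriv (A : MvPolynomial (Fin 4) k) (j i l m : ℤ) :
    (variationalDeriv κ f₂ f₁ e₁ e₂ A).intCoeff ![j, i, l, m] =
      κ (A.intCoeff ![j - 2, i, l, m]) + (j - 2) * A.intCoeff ![j - 2, i - 1, l, m]
      + (i + 1) * (f₂ * A.intCoeff ![j - 4, i + 1, l, m] + f₁ * A.intCoeff ![j - 3, i + 1, l, m]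
        + e₁ * A.intCoeff ![j - 1, i + 1, l, m] + e₂ * A.intCoeff ![j, i + 1, l, m])
      + (l + 1) * A.intCoeff ![j - 2, i, l + 1, m - 1]
      + (m + 1) * (2 * f₂ * A.intCoeff ![j - 4, i, l - 1, m + 1]
        + f₁ * A.intCoeff ![j - 3, i, l - 1, m + 1]
        - e₁ * A.intCoeff ![j - 1, i, l - 1, m + 1]
        - 2 * e₂ * A.intCoeff ![j, i, l - 1, m + 1]) := by
  have e : variationalDeriv κ f₂ f₁ e₁ e₂ A = X 0 ^ 2 * coeffDeriv κ A
      + X 0 ^ 3 * (X 1 * pderiv 0 A)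
      + (C f₂ * (X 0 ^ 4 * pderiv 1 A) + C f₁ * (X 0 ^ 3 * pderiv 1 A)
        + C e₁ * (X 0 ^ 1 * pderiv 1 A) + C e₂ * pderiv 1 A)
      + X 0 ^ 2 * (X 3 * pderiv 2 A)
      + (C (2 * f₂) * (X 0 ^ 4 * (X 2 * pderiv 3 A)) + C f₁ * (X 0 ^ 3 * (X 2 * pderiv 3 A))
        + C (-e₁) * (X 0 ^ 1 * (X 2 * pderiv 3 A)) + C (-2 * e₂) * (X 2 * pderiv 3 A)) := by
    rw [variationalDeriv_apply]; ring
  rw [e]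
  simp only [intCoeff_add, intCoeff_C_mul, intCoeff_X_zero_pow_mul, intCoeff_X_one_mul,
    intCoeff_X_two_mul, intCoeff_X_three_mul, intCoeff_pderiv_zero, intCoeff_pderiv_one,
    intCoeff_pderiv_two, intCoeff_pderiv_three, intCoeff_coeffDeriv, Nat.cast_ofNat, Nat.cast_one,
    show j - 3 + 1 = j - 2 by ring]
  push_cast
  ring

/-- The shifts of exponents occurring in `variationalDeriv`. -/
theorem exists_intCoeff_ne_zero_of_variationalDeriv {A : MvPolynomial (Fin 4) k} {j i l m : ℤ}
    (h : (variationalDeriv κ f₂ f₁ e₁ e₂ A).intCoeff ![j, i, l, m] ≠ 0) :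
    ∃ a b c d : ℤ, A.intCoeff ![j - a, i - b, l - c, m - d] ≠ 0 ∧ c + d = 0 ∧ b ≤ 1 ∧
      a + b + d ≤ 3 ∧ -a + b + d ≤ -1 := by
  by_contra! hne
  have key : ∀ a b c d : ℤ, c + d = 0 → b ≤ 1 → a + b + d ≤ 3 → -a + b + d ≤ -1 →
      A.intCoeff ![j - a, i - b, l - c, m - d] = 0 := by
    intro a b c d h1 h2 h3 h4
    by_contra h5
    have := hne a b c d h5 h1 h2 h3
    omega
  refine h ?_
  have k1 := key 2 0 0 0 (by norm_num) (by norm_num) (by norm_num) (by norm_num)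
  have k2 := key 2 1 0 0 (by norm_num) (by norm_num) (by norm_num) (by norm_num)
  have k3 := key 4 (-1) 0 0 (by norm_num) (by norm_num) (by norm_num) (by norm_num)
  have k4 := key 3 (-1) 0 0 (by norm_num) (by norm_num) (by norm_num) (by norm_num)
  have k5 := key 1 (-1) 0 0 (by norm_num) (by norm_num) (by norm_num) (by norm_num)
  have k6 := key 0 (-1) 0 0 (by norm_num) (by norm_num) (by norm_num) (by norm_num)
  have k7 := key 2 0 (-1) 1 (by norm_num) (by norm_num) (by norm_num) (by norm_num)
  have k8 := key 4 0 1 (-1) (by norm_num) (by norm_num) (by norm_num) (by norm_num)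
  have k9 := key 3 0 1 (-1) (by norm_num) (by norm_num) (by norm_num) (by norm_num)
  have k10 := key 1 0 1 (-1) (by norm_num) (by norm_num) (by norm_num) (by norm_num)
  have k11 := key 0 0 1 (-1) (by norm_num) (by norm_num) (by norm_num) (by norm_num)
  simp only [sub_zero, sub_neg_eq_add] at k1 k2 k3 k4 k5 k6 k7 k8 k9 k10 k11
  rw [intCoeff_variationalDeriv, k1, k2, k3, k4, k5, k6, k7, k8, k9, k10, k11]
  simp

/-- A weight bound for the cofactor of a polynomial dividing its derivative. -/
theorem weight_le_of_variationalDeriv_eq (w : Fin 4 → ℤ) (r : ℤ)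
    (hw : ∀ a b c d : ℤ, c + d = 0 → b ≤ 1 → a + b + d ≤ 3 → -a + b + d ≤ -1 →
      w 0 * a + w 1 * b + w 2 * c + w 3 * d ≤ r)
    {A H : MvPolynomial (Fin 4) k} (hA : A ≠ 0)
    (h : variationalDeriv κ f₂ f₁ e₁ e₂ A = H * A) {m : Fin 4 →₀ ℕ} (hm : coeff m H ≠ 0) :
    w 0 * m 0 + w 1 * m 1 + w 2 * m 2 + w 3 * m 3 ≤ r := by
  let wt : (Fin 4 →₀ ℕ) →+ ℤ :=
    { toFun := fun m => w 0 * m 0 + w 1 * m 1 + w 2 * m 2 + w 3 * m 3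
      map_zero' := by simp
      map_add' := fun a b => by simp; ring }
  obtain ⟨q, hq, hqmax⟩ := A.support.exists_max_image wt (support_nonempty.2 hA)
  refine weight_le_of_mul wt (N := wt q) ⟨q, mem_support_iff.1 hq, rfl⟩
    (fun m hm => hqmax m (mem_support_iff.2 hm)) (fun p hp => ?_) m hm
  rw [← h, ← intCoeff_natCast, show (fun i => (p i : ℤ)) = ![(p 0 : ℤ), p 1, p 2, p 3] by
    ext i; fin_cases i <;> rfl] at hp
  obtain ⟨a, b, c, d, hne, h1, h2, h3, h4⟩ :=
    exists_intCoeff_ne_zero_of_variationalDeriv κ f₂ f₁ e₁ e₂ hp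
  obtain ⟨p', hp', hpp⟩ := exists_intCoeff_eq A hne
  have hb := hqmax p' (mem_support_iff.2 hp')
  have hs := hw a b c d h1 h2 h3 h4
  have h0 : (p 0 : ℤ) - a = p' 0 := congrFun hpp 0
  have h1 : (p 1 : ℤ) - b = p' 1 := congrFun hpp 1
  have h2 : (p 2 : ℤ) - c = p' 2 := congrFun hpp 2
  have h3 : (p 3 : ℤ) - d = p' 3 := congrFun hpp 3
  have e1 : wt p' = w 0 * (p' 0 : ℤ) + w 1 * (p' 1 : ℤ) + w 2 * (p' 2 : ℤ) + w 3 * (p' 3 : ℤ) := rfl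
  have e2 : wt p = w 0 * (p 0 : ℤ) + w 1 * (p 1 : ℤ) + w 2 * (p 2 : ℤ) + w 3 * (p 3 : ℤ) := rfl
  rw [← h0, ← h1, ← h2, ← h3] at e1
  linarith

theorem exists_cofactor_eq {A H : MvPolynomial (Fin 4) k} (hA : A ≠ 0)
    (h : variationalDeriv κ f₂ f₁ e₁ e₂ A = H * A) :
    ∃ K₀ g lam g' : k, H = C K₀ * (X 0 ^ 2 * X 1) + C g * X 0 ^ 3 + C lam * X 0 ^ 2 +
      C g' * X 0 ^ 1 := by
  have e0 : X 0 ^ 2 * X 1 = (monomial (Finsupp.single 0 2 + Finsupp.single 1 1) 1 :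
      MvPolynomial (Fin 4) k) := by
    rw [X_pow_eq_monomial, X, monomial_mul, mul_one]
  refine ⟨coeff (Finsupp.single 0 2 + Finsupp.single 1 1) H, coeff (Finsupp.single 0 3) H,
    coeff (Finsupp.single 0 2) H, coeff (Finsupp.single 0 1) H, ?_⟩
  rw [e0]
  ext m
  simp only [X_pow_eq_monomial, coeff_add, coeff_C_mul, coeff_monomial]
  have heq : ∀ m' : Fin 4 →₀ ℕ, m' = m ↔ m' 0 = m 0 ∧ m' 1 = m 1 ∧ m' 2 = m 2 ∧ m' 3 = m 3 := by
    intro m'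
    constructor
    · rintro rfl; simp
    · rintro ⟨h0, h1, h2, h3⟩
      ext i; fin_cases i <;> assumption
  have q0 : (Finsupp.single 0 2 + Finsupp.single 1 1 : Fin 4 →₀ ℕ) = m ↔
      m 0 = 2 ∧ m 1 = 1 ∧ m 2 = 0 ∧ m 3 = 0 := by
    rw [heq]; simp [eq_comm]
  have q1 : ∀ e : ℕ, (Finsupp.single 0 e : Fin 4 →₀ ℕ) = m ↔
      m 0 = e ∧ m 1 = 0 ∧ m 2 = 0 ∧ m 3 = 0 := by
    intro e
    rw [heq]; simp [eq_comm]
  by_cases hm : coeff m H = 0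
  · have : ∀ m' : Fin 4 →₀ ℕ, coeff m' H * (if m' = m then (1 : k) else 0) = 0 := by
      intro m'
      split_ifs with h
      · rw [h, hm, zero_mul]
      · rw [mul_zero]
    simp only [this, hm, add_zero]
  · have w1 := weight_le_of_variationalDeriv_eq κ f₂ f₁ e₁ e₂ ![0, 0, 1, 1] 0
      (by intro a b c d; simp; omega) hA h hm
    have w2 := weight_le_of_variationalDeriv_eq κ f₂ f₁ e₁ e₂ ![0, 1, 0, 0] 1
      (by intro a b c d; simp; omega) hA h hm
    have w3 := weight_le_of_variationalDeriv_eq κ f₂ f₁ e₁ e₂ ![1, 1, 0, 1] 3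
      (by intro a b c d; simp; omega) hA h hm
    have w4 := weight_le_of_variationalDeriv_eq κ f₂ f₁ e₁ e₂ ![-1, 1, 0, 1] (-1)
      (by intro a b c d; simp) hA h hm
    simp at w1 w2 w3 w4
    have hcase : (m 0 = 2 ∧ m 1 = 1 ∧ m 2 = 0 ∧ m 3 = 0) ∨ (m 0 = 3 ∧ m 1 = 0 ∧ m 2 = 0 ∧ m 3 = 0)
        ∨ (m 0 = 2 ∧ m 1 = 0 ∧ m 2 = 0 ∧ m 3 = 0) ∨ (m 0 = 1 ∧ m 1 = 0 ∧ m 2 = 0 ∧ m 3 = 0) := by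
      omega
    rcases hcase with h | h | h | h
    · rw [if_pos (q0.2 h), if_neg (by rw [q1]; omega), if_neg (by rw [q1]; omega),
        if_neg (by rw [q1]; omega), q0.2 h]
      ring
    · rw [if_pos ((q1 _).2 h), if_neg (by rw [q0]; omega), if_neg (by rw [q1]; omega),
        if_neg (by rw [q1]; omega), (q1 _).2 h]
      ring
    · rw [if_pos ((q1 _).2 h), if_neg (by rw [q0]; omega), if_neg (by rw [q1]; omega),
        if_neg (by rw [q1]; omega), (q1 _).2 h]
      ring
    · rw [if_pos ((q1 _).2 h), if_neg (by rw [q0]; omega), if_neg (by rw [q1]; omega),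
        if_neg (by rw [q1]; omega), (q1 _).2 h]
      ring

/-- The only polynomials dividing their derivative are the monomials in the first variable. -/
theorem eq_C_mul_X_pow_of_dvd_variationalDeriv {k : Type*} [Field k] [CharZero k]
    (κ : Derivation ℤ k k) (s r α β : k) (hs : s ≠ 0) (hr : r ≠ 0) (hκs : κ s = s) (hκr : κ r = r)
    (hα : κ α = 0) (hβ : κ β = 0)
    (hgen : ∀ (a : ℕ) (m m' : ℤ), 2 * (a : k) + m * α + m' * β = 0 → a = 0)
    {A : MvPolynomial (Fin 4) k} (hA : A ≠ 0)
    (h : A ∣ variationalDeriv κ (s ^ 2) (α * s) (-(β * r)) (-(r ^ 2)) A) :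
    ∃ (c : k) (e : ℕ), A = C c * X 0 ^ e := by
  obtain ⟨H, hH⟩ := h
  replace hH := hH.trans (mul_comm _ _)
  obtain ⟨K₀, g, lam, g', rfl⟩ := exists_cofactor_eq _ _ _ _ _ hA hH
  have hneg : ∀ {j i l m : ℤ}, A.intCoeff ![j, i, l, m] ≠ 0 →
      ∃ p : Fin 4 →₀ ℕ, coeff p A ≠ 0 ∧ j = p 0 ∧ i = p 1 ∧ l = p 2 ∧ m = p 3 := by
    intro j i l m hne
    obtain ⟨p, hp, hpe⟩ := exists_intCoeff_eq A hne
    exact ⟨p, hp, congrFun hpe 0, congrFun hpe 1, congrFun hpe 2, congrFun hpe 3⟩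
  have hdeg : ∀ (p : Fin 4 →₀ ℕ) (i : Fin 4), coeff p A ≠ 0 → p i ≤ A.totalDegree := by
    intro p i hp
    refine le_trans ?_ (le_totalDegree (mem_support_iff.2 hp))
    rw [Finsupp.sum_fintype _ _ (by simp)]
    exact Finset.single_le_sum (f := fun i => p i) (fun _ _ => Nat.zero_le _) (Finset.mem_univ i)
  have key : ∀ p : Fin 4 →₀ ℕ, coeff p A ≠ 0 →
      p 2 + p 3 = 0 ∧ ∃ j₀ : ℤ, ∀ j i l : ℤ,
        A.intCoeff ![j, i, l, (p 2 + p 3 : ℕ) - l] ≠ 0 → j = j₀ ∧ i = 0 ∧ l = 0 := by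
    intro p hp
    refine slice_support κ s r α β g g' lam K₀ hs hr hκs hκr hα hβ hgen (p 2 + p 3)
      (fun j i l => A.intCoeff ![j, i, l, (p 2 + p 3 : ℕ) - l]) A.totalDegree
      ⟨p 0, p 1, p 2, ?_⟩ ?_ ?_ ?_ ?_ ?_ ?_
    · have : (![(p 0 : ℤ), p 1, p 2, (p 2 + p 3 : ℕ) - p 2] : Fin 4 → ℤ) = fun i => (p i : ℤ) := by
        ext i; fin_cases i <;> simp
      rw [this, intCoeff_natCast]
      exact hp
    · exact fun j i l hi => intCoeff_eq_zero A (i := 1) hi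
    · exact fun j i l hi => intCoeff_eq_zero A (i := 2) hi
    · exact fun j i l hi => intCoeff_eq_zero A (i := 3) (by simp at hi ⊢; omega)
    · intro j i l hN
      by_contra hne
      obtain ⟨q, hq, h0, -⟩ := hneg hne
      have := hdeg q 0 hq
      rw [h0, abs_of_nonneg (by positivity)] at hN
      omega
    · intro j i l hN
      by_contra hne
      obtain ⟨q, hq, -, h1, -⟩ := hneg hne
      have := hdeg q 1 hq
      omega
    · intro j i l
      have h := congrArg (fun B => intCoeff B ![j + 2, i, l, (p 2 + p 3 : ℕ) - l]) hH
      have e : (C K₀ * (X 0 ^ 2 * X 1) + C g * X 0 ^ 3 + C lam * X 0 ^ 2 + C g' * X 0 ^ 1) * A =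
          C K₀ * (X 0 ^ 2 * (X 1 * A)) + C g * (X 0 ^ 3 * A) + C lam * (X 0 ^ 2 * A)
            + C g' * (X 0 ^ 1 * A) := by ring
      simp only [intCoeff_variationalDeriv, e, intCoeff_add, intCoeff_C_mul,
        intCoeff_X_zero_pow_mul, intCoeff_X_one_mul, Nat.cast_ofNat, Nat.cast_one,
        show j + 2 - 2 = j by ring, show j + 2 - 4 = j - 2 by ring,
        show j + 2 - 3 = j - 1 by ring, show j + 2 - 1 = j + 1 by ring] at h
      simp only [show ((p 2 + p 3 : ℕ) : ℤ) - (l + 1) = (p 2 + p 3 : ℕ) - l - 1 by ring,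
        show ((p 2 + p 3 : ℕ) : ℤ) - (l - 1) = (p 2 + p 3 : ℕ) - l + 1 by ring]
      push_cast at h ⊢
      linear_combination h
  obtain ⟨p, hp⟩ := support_nonempty.2 hA
  obtain ⟨hp0, j₀, hj₀⟩ := key p (mem_support_iff.1 hp)
  have hall : ∀ q : Fin 4 →₀ ℕ, coeff q A ≠ 0 → q = Finsupp.single 0 j₀.toNat := by
    intro q hq
    obtain ⟨hq0, -⟩ := key q hq
    have := hj₀ (q 0) (q 1) (q 2) (by
      rw [show (![(q 0 : ℤ), q 1, q 2, (p 2 + p 3 : ℕ) - q 2] : Fin 4 → ℤ) = fun i => (q i : ℤ) by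
        ext i; fin_cases i
        all_goals simp
        omega, intCoeff_natCast]
      exact hq)
    ext i
    fin_cases i
    · simp; omega
    · simp; omega
    · simp; omega
    · simp; omega
  refine ⟨coeff (Finsupp.single 0 j₀.toNat) A, j₀.toNat, ?_⟩
  rw [X_pow_eq_monomial, C_mul_monomial, mul_one]
  ext q
  rw [coeff_monomial]
  split_ifs with hq
  · rw [hq]
  · by_contra hne
    exact hq (hall q hne).symm

end

section

open Polynomial

variable {k L : Type*} [Field k] [Field L] [Algebra k L]

theorem Derivation.exists_aeval_eq (κ : Derivation ℤ k k) (d : Derivation ℤ L L)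
    (h : ∀ a, d (algebraMap k L a) = algebraMap k L (κ a)) (p : k[X]) :
    ∃ q : k[X], (∀ i, q.coeff i = κ (p.coeff i)) ∧
      ∀ m : L, d (aeval m p) = aeval m q + aeval m (derivative p) * d m := by
  let _ : Differential k := ⟨κ⟩
  let _ : Differential L := ⟨d⟩
  have : DifferentialAlgebra k L := ⟨h⟩
  exact ⟨Differential.mapCoeffs p, fun i => rfl, fun m => Differential.deriv_aeval_eq m p⟩

/-- A derivation preserving a field preserves its relative algebraic closure. -/
theorem Derivation.isAlgebraic_apply [CharZero k] (κ : Derivation ℤ k k) (d : Derivation ℤ L L)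
    (h : ∀ a, d (algebraMap k L a) = algebraMap k L (κ a)) {m : L} (hm : IsAlgebraic k m) :
    IsAlgebraic k (d m) := by
  obtain ⟨q, -, hq⟩ := Derivation.exists_aeval_eq κ d h (minpoly k m)
  have hs : aeval m (derivative (minpoly k m)) ≠ 0 :=
    (minpoly.irreducible hm.isIntegral).separable.aeval_derivative_ne_zero (minpoly.aeval k m)
  have h1 := hq m
  rw [minpoly.aeval, map_zero] at h1
  have h2 : d m = -(aeval m q) / aeval m (derivative (minpoly k m)) := by
    rw [eq_div_iff hs]; linear_combination -h1
  have h3 : ∀ p : k[X], IsAlgebraic k (aeval m p) := fun p =>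
    (IsIntegral.of_mem_of_fg (Algebra.adjoin k {m}) hm.isIntegral.fg_adjoin_singleton _
      (aeval_mem_adjoin_singleton k m)).isAlgebraic
  rw [h2, div_eq_mul_inv]
  exact (h3 q).neg.mul (h3 _).inv

theorem Derivation.eq_zero_of_isAlgebraic [CharZero k] (d : Derivation ℤ L L)
    (h : ∀ a, d (algebraMap k L a) = 0) {m : L} (hm : IsAlgebraic k m) : d m = 0 := by
  obtain ⟨q, hq0, hq⟩ := Derivation.exists_aeval_eq 0 d (fun a => by simp [h]) (minpoly k m)
  have hs : aeval m (derivative (minpoly k m)) ≠ 0 :=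
    (minpoly.irreducible hm.isIntegral).separable.aeval_derivative_ne_zero (minpoly.aeval k m)
  have h1 := hq m
  have : q = 0 := by ext i; simp [hq0]
  rw [minpoly.aeval, map_zero, this, map_zero, zero_add] at h1
  exact (mul_eq_zero.1 h1.symm).resolve_left hs

/-- The minimal polynomial of a constant has constant coefficients. -/
theorem Derivation.coeff_minpoly_eq_zero (κ : Derivation ℤ k k) (d : Derivation ℤ L L)
    (h : ∀ a, d (algebraMap k L a) = algebraMap k L (κ a)) {m : L} (hm : IsAlgebraic k m)
    (hdm : d m = 0) (i : ℕ) : κ ((minpoly k m).coeff i) = 0 := by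
  obtain ⟨q, hq0, hq⟩ := Derivation.exists_aeval_eq κ d h (minpoly k m)
  have h1 := hq m
  rw [minpoly.aeval, map_zero, hdm, mul_zero, add_zero] at h1
  have hdeg : q.degree < (minpoly k m).degree := by
    rw [Polynomial.degree_eq_natDegree (minpoly.ne_zero hm.isIntegral), Polynomial.degree_lt_iff_coeff_zero]
    intro j hj
    rw [hq0]
    rcases hj.eq_or_lt with hj | hj
    · rw [← hj, Polynomial.coeff_natDegree, minpoly.monic hm.isIntegral, Derivation.map_one_eq_zero]
    · rw [Polynomial.coeff_eq_zero_of_natDegree_lt hj, map_zero]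
  have h0 : q = 0 := by
    by_contra hne
    exact absurd (minpoly.degree_le_of_ne_zero k m hne h1.symm) (not_le.2 hdeg)
  rw [← hq0, h0, Polynomial.coeff_zero]

end

/-- Derivations extend along formally étale algebras. -/
theorem Derivation.exists_extension_of_formallyEtale {R S T : Type*} [CommRing R] [CommRing S]
    [CommRing T] [Algebra R S] [Algebra S T] [Algebra R T] [IsScalarTower R S T]
    [Algebra.FormallyEtale S T] (d : Derivation R S T) :
    ∃ D : Derivation R T T, ∀ s, D (algebraMap S T s) = d s := by
  let e := KaehlerDifferential.tensorKaehlerEquivOfFormallyEtale R S T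
  let ℓ : TensorProduct S T (Ω[S⁄R]) →ₗ[T] T := (d.liftKaehlerDifferential).liftBaseChange T
  refine ⟨(ℓ.comp e.symm.toLinearMap).compDer (KaehlerDifferential.D R T), fun s => ?_⟩
  change ℓ (e.symm (KaehlerDifferential.D R T (algebraMap S T s))) = d s
  rw [KaehlerDifferential.tensorKaehlerEquivOfFormallyEtale_symm_D_algebraMap]
  simp [ℓ]

/-- A derivation can be prescribed arbitrarily on a transcendence basis. -/
theorem IsTranscendenceBasis.exists_derivation {k L ι : Type*} [Field k] [CharZero k] [Field L]
    [Algebra k L] {x : ι → L} (hx : IsTranscendenceBasis k x) (c : ι → L) :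
    ∃ D : Derivation k L L, ∀ i, D (x i) = c i := by
  let _ : Algebra (MvPolynomial ι k) L := (MvPolynomial.aeval x).toAlgebra
  have hmap : ∀ p, algebraMap (MvPolynomial ι k) L p = MvPolynomial.aeval x p := fun _ => rfl
  have : IsScalarTower k (MvPolynomial ι k) L := IsScalarTower.of_algebraMap_eq fun a => by
    rw [hmap, MvPolynomial.algebraMap_eq, MvPolynomial.aeval_C]
  have : FaithfulSMul (MvPolynomial ι k) L :=
    (faithfulSMul_iff_algebraMap_injective _ _).2 hx.1
  have halg : Algebra.IsAlgebraic (MvPolynomial ι k) L := by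
    have := hx.isAlgebraic
    refine ⟨fun a => ?_⟩
    refine IsAlgebraic.of_ringHom_of_comp_eq (S := Algebra.adjoin k (Set.range x)) (B := L)
      hx.1.aevalEquiv (RingHom.id L) (this.isAlgebraic a) hx.1.aevalEquiv.surjective
      Function.injective_id ?_
    ext <;> simp [hmap]
  let _ : Algebra (FractionRing (MvPolynomial ι k)) L := FractionRing.liftAlgebra _ _
  have : Algebra.IsAlgebraic (FractionRing (MvPolynomial ι k)) L :=
    IsFractionRing.comap_isAlgebraic_iff.1 halg
  have : Algebra.FormallyEtale (FractionRing (MvPolynomial ι k)) L :=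
    Algebra.FormallyEtale.of_isSeparable _ _
  have : Algebra.FormallyEtale (MvPolynomial ι k) (FractionRing (MvPolynomial ι k)) :=
    Algebra.FormallyEtale.of_isLocalization (nonZeroDivisors (MvPolynomial ι k))
  have : Algebra.FormallyEtale (MvPolynomial ι k) L :=
    Algebra.FormallyEtale.comp _ (FractionRing (MvPolynomial ι k)) _
  obtain ⟨D, hD⟩ := Derivation.exists_extension_of_formallyEtale (T := L)
    (MvPolynomial.mkDerivation k c)
  refine ⟨D, fun i => ?_⟩
  have := hD (MvPolynomial.X i)
  rwa [hmap, MvPolynomial.aeval_X, MvPolynomial.mkDerivation_X] at this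

/-- A derivation can be prescribed arbitrarily on an algebraically independent family. -/
theorem AlgebraicIndependent.exists_derivation {k L ι : Type*} [Field k] [CharZero k] [Field L]
    [Algebra k L] {x : ι → L} (hx : AlgebraicIndependent k x) (c : ι → L) :
    ∃ D : Derivation k L L, ∀ i, D (x i) = c i := by
  obtain ⟨t, hst, ht⟩ := exists_isTranscendenceBasis_superset hx.coe_range
  obtain ⟨D, hD⟩ := ht.exists_derivation (Function.extend x c 0 ∘ ((↑) : t → L))
  refine ⟨D, fun i => ?_⟩
  have := hD ⟨x i, hst ⟨i, rfl⟩⟩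
  rwa [Function.comp_apply, hx.injective.extend_apply] at this

/-- A derivation of a domain extends to its fraction field. -/
theorem Derivation.exists_extension_isFractionRing {R Ω : Type*} [CommRing R] [Field Ω]
    [Algebra R Ω] [IsFractionRing R Ω] (d : Derivation ℤ R R) :
    ∃ D : Derivation ℤ Ω Ω, ∀ a, D (algebraMap R Ω a) = algebraMap R Ω (d a) := by
  have : Algebra.FormallyEtale R Ω :=
    Algebra.FormallyEtale.of_isLocalization (nonZeroDivisors R)
  exact Derivation.exists_extension_of_formallyEtale (R := ℤ)
    (LinearMap.compDer (Algebra.linearMap R Ω) d)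

section

open Polynomial

/-- The polynomials over a UFD vanishing at an algebraic point form a principal ideal. -/
theorem IsAlgebraic.exists_forall_dvd {R L : Type*} [CommRing R] [IsDomain R]
    [UniqueFactorizationMonoid R] [Field L] [Algebra R L] [FaithfulSMul R L] {z : L}
    (hz : IsAlgebraic R z) :
    ∃ P : R[X], P ≠ 0 ∧ aeval z P = 0 ∧ ∀ Q : R[X], aeval z Q = 0 → P ∣ Q := by
  let _ : Algebra (FractionRing R) L := FractionRing.liftAlgebra _ _
  have hI : RingHom.ker (aeval (R := R) z) ≠ ⊥ := by
    obtain ⟨p, hp, hpz⟩ := hz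
    exact fun h => hp (by simpa [h] using (show p ∈ RingHom.ker (aeval (R := R) z) from hpz))
  obtain ⟨P, hPI, hP⟩ := Ideal.IsPrime.exists_mem_prime_of_ne_bot
    (RingHom.ker_isPrime (aeval (R := R) z)) hI
  have hPz : aeval z P = 0 := hPI
  have hdeg : P.natDegree ≠ 0 := fun h0 => by
    rw [Polynomial.eq_C_of_natDegree_eq_zero h0, aeval_C,
      FaithfulSMul.algebraMap_eq_zero_iff R L] at hPz
    apply hP.ne_zero
    rw [Polynomial.eq_C_of_natDegree_eq_zero h0, hPz, C_0]
  have hprim := hP.irreducible.isPrimitive hdeg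
  have hirr := (hprim.irreducible_iff_irreducible_map_fraction_map
    (K := FractionRing R)).1 hP.irreducible
  have hmap : ∀ Q : R[X], aeval z Q = 0 →
      minpoly (FractionRing R) z ∣ Q.map (algebraMap R (FractionRing R)) := fun Q hQ =>
    minpoly.dvd _ _ (by rw [aeval_map_algebraMap, hQ])
  have hnu : ¬ IsUnit (minpoly (FractionRing R) z) := minpoly.not_isUnit _ _
  have hassoc := (hirr.dvd_iff.1 (hmap P hPz)).resolve_left hnu
  exact ⟨P, hP.ne_zero, hPz, fun Q hQ =>
    hprim.dvd_of_fraction_map_dvd_fraction_map (hassoc.dvd.trans (hmap Q hQ))⟩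

end

/-- Parameters `s, r, α, β` of a generic equation `∂ y = y z`,
`∂ z = s² y² + α s y - β r y⁻¹ - r² y⁻²` over the differential field `(k, κ)`. -/
structure IsGenericParam {k : Type*} [Field k] (κ : Derivation ℤ k k) (s r α β : k) : Prop where
  s_ne_zero : s ≠ 0
  r_ne_zero : r ≠ 0
  s_deriv : κ s = s
  r_deriv : κ r = r
  α_deriv : κ α = 0
  β_deriv : κ β = 0
  generic : ∀ (a : ℕ) (m m' : ℤ), 2 * (a : k) + m * α + m' * β = 0 → a = 0

/-- `x = ![y, z, ξ, η]` satisfies the equation with parameters `s, r, α, β` together with its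
linearisation, with respect to the derivation `d`. -/
structure IsVariationalSolution {k Ω : Type*} [Field k] [Field Ω] [Algebra k Ω]
    (s r α β : k) (d : Derivation ℤ Ω Ω) (x : Fin 4 → Ω) : Prop where
  y_ne_zero : x 0 ≠ 0
  y_deriv : d (x 0) = x 0 * x 1
  z_deriv : x 0 ^ 2 * d (x 1) = algebraMap k Ω (s ^ 2) * x 0 ^ 4 + algebraMap k Ω (α * s) * x 0 ^ 3
    + algebraMap k Ω (-(β * r)) * x 0 + algebraMap k Ω (-(r ^ 2))
  ξ_deriv : d (x 2) = x 3
  η_deriv : x 0 ^ 2 * d (x 3) = (algebraMap k Ω (2 * s ^ 2) * x 0 ^ 4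
    + algebraMap k Ω (α * s) * x 0 ^ 3 + algebraMap k Ω (-(-(β * r))) * x 0
    + algebraMap k Ω (-2 * -(r ^ 2))) * x 2

section

open MvPolynomial

variable {k Ω : Type*} [Field k] [Field Ω] [Algebra k Ω] {κ : Derivation ℤ k k} {s r α β : k}
  {d : Derivation ℤ Ω Ω} {x : Fin 4 → Ω}

theorem IsVariationalSolution.aeval_variationalDeriv (hx : IsVariationalSolution s r α β d x)
    (h : ∀ a, d (algebraMap k Ω a) = algebraMap k Ω (κ a)) (A : MvPolynomial (Fin 4) k) :
    aeval x (variationalDeriv κ (s ^ 2) (α * s) (-(β * r)) (-(r ^ 2)) A) =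
      x 0 ^ 2 * d (aeval x A) := by
  induction A using MvPolynomial.induction_on with
  | C a =>
    simp [variationalDeriv_apply, coeffDeriv_C, h]
  | add p q hp hq => rw [map_add, map_add, map_add, hp, hq, map_add, mul_add]
  | mul_X p i hp =>
    rw [Derivation.leibniz, map_add, smul_eq_mul, smul_eq_mul, map_mul, map_mul, hp, map_mul,
      Derivation.leibniz, smul_eq_mul, smul_eq_mul, mul_add, aeval_X]
    have : aeval x (variationalDeriv κ (s ^ 2) (α * s) (-(β * r)) (-(r ^ 2)) (X i)) =
        x 0 ^ 2 * d (x i) := by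
      rw [variationalDeriv_apply, coeffDeriv_X]
      fin_cases i
      · simp [pderiv_X, hx.y_deriv]; ring
      · simp only [Fin.mk_one, hx.z_deriv]; simp [pderiv_X]
      · simp [pderiv_X, hx.ξ_deriv]
      · simp only [Fin.reduceFinMk, hx.η_deriv]; simp [pderiv_X]
    rw [this]
    ring

end

namespace AlgebraicIndependent

variable {k Ω : Type*} [Field k] [Field Ω] [Algebra k Ω]

theorem mem_matroid_closure_iff {s : Set Ω} {a : Ω} :
    a ∈ (matroid k Ω).closure s ↔ IsAlgebraic (IntermediateField.adjoin k s) a := by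
  rw [matroid_closure_eq, SetLike.mem_coe, Subalgebra.mem_algebraicClosure,
    IntermediateField.isAlgebraic_adjoin_iff]

theorem pair_of_notMem_closure {a b : Ω} (ha : Transcendental k a)
    (hb : b ∉ (matroid k Ω).closure {a}) : AlgebraicIndependent k ![a, b] := by
  have hne : a ≠ b := fun h => hb (h ▸ (matroid k Ω).mem_closure_of_mem rfl)
  have hinj : Function.Injective ![a, b] := by
    intro i j hij
    fin_cases i <;> fin_cases j <;> simp_all [eq_comm]
  have h1 : (matroid k Ω).Indep {a} := by
    rw [matroid_indep_iff]
    exact (algebraicIndependent_singleton_iff (⟨a, rfl⟩ : ({a} : Set Ω))).2 ha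
  have h2 : (matroid k Ω).Indep (insert b {a}) :=
    h1.insert_indep_iff.2 (Or.inl ⟨Set.mem_univ _, hb⟩)
  rw [matroid_indep_iff] at h2
  rw [← algebraicIndependent_subtype_range hinj]
  have : Set.range ![a, b] = insert b {a} := by simp
  rw [this]
  exact h2

end AlgebraicIndependent

section

open MvPolynomial

variable {k Ω : Type*} [Field k] [CharZero k] [Field Ω] [Algebra k Ω] {κ : Derivation ℤ k k}
  {s r α β : k} {d : Derivation ℤ Ω Ω}

/-- A solution that is not generic is algebraic. -/
theorem IsVariationalSolution.isAlgebraic_of_not_algebraicIndependent {y z : Ω}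
    (hg : IsGenericParam κ s r α β)
    (h : ∀ a, d (algebraMap k Ω a) = algebraMap k Ω (κ a))
    (hx : IsVariationalSolution s r α β d ![y, z, 0, 0])
    (hdep : ¬ AlgebraicIndependent k ![y, z]) : IsAlgebraic k y ∧ IsAlgebraic k z := by
  have hy0 : y ≠ 0 := hx.y_ne_zero
  by_cases hy : IsAlgebraic k y
  · refine ⟨hy, ?_⟩
    have : z = d y * y⁻¹ := by
      rw [show d y = y * z from hx.y_deriv]; field_simp
    rw [this]
    exact (Derivation.isAlgebraic_apply κ d h hy).mul hy.inv
  exfalso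
  let _ : Algebra (Polynomial k) Ω := (Polynomial.aeval y).toAlgebra
  have hmap : ∀ p, algebraMap (Polynomial k) Ω p = Polynomial.aeval y p := fun _ => rfl
  have : IsScalarTower k (Polynomial k) Ω := IsScalarTower.of_algebraMap_eq fun a => by
    rw [hmap, Polynomial.algebraMap_eq, Polynomial.aeval_C]
  have hf : FaithfulSMul (Polynomial k) Ω := (faithfulSMul_iff_algebraMap_injective _ _).2
    (transcendental_iff_injective.1 hy)
  have hz : IsAlgebraic (Polynomial k) z := by
    by_contra hz
    refine hdep (AlgebraicIndependent.pair_of_notMem_closure hy fun hz' => hz ?_)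
    rw [AlgebraicIndependent.matroid_closure_eq, SetLike.mem_coe,
      Subalgebra.mem_algebraicClosure] at hz'
    have hsurj : Function.Surjective ((Polynomial.aeval y : Polynomial k →ₐ[k] Ω).codRestrict
        (Algebra.adjoin k {y}) (fun p => Polynomial.aeval_mem_adjoin_singleton k y)) := by
      rintro ⟨a, ha⟩
      rw [Algebra.adjoin_singleton_eq_range_aeval] at ha
      obtain ⟨p, rfl⟩ := ha
      exact ⟨p, rfl⟩
    exact IsAlgebraic.of_ringHom_of_comp_eq (S := Algebra.adjoin k {y}) (B := Ω)
      ((Polynomial.aeval y : Polynomial k →ₐ[k] Ω).codRestrict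
        (Algebra.adjoin k {y}) (fun p => Polynomial.aeval_mem_adjoin_singleton k y))
      (RingHom.id Ω) hz' hsurj Function.injective_id (by ext <;> simp [hmap])
  obtain ⟨P, hP0, hPz, hP⟩ := hz.exists_forall_dvd
  let φ : Polynomial (Polynomial k) →+* MvPolynomial (Fin 4) k :=
    Polynomial.eval₂RingHom (Polynomial.aeval (X 0) : Polynomial k →ₐ[k] MvPolynomial (Fin 4) k).toRingHom (X 1)
  have hφC : ∀ a : k, φ (Polynomial.C (Polynomial.C a)) = C a := fun a => by
    simp [φ, MvPolynomial.algebraMap_eq]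
  have hφ0 : φ (Polynomial.C Polynomial.X) = X 0 := by simp [φ]
  have hφ1 : φ Polynomial.X = X 1 := by simp [φ]
  let ψ : MvPolynomial (Fin 4) k →ₐ[k] Polynomial (Polynomial k) :=
    aeval ![Polynomial.C Polynomial.X, Polynomial.X, 0, 0]
  have hψ : ∀ p, ψ (φ p) = p := by
    intro p
    have : (ψ : MvPolynomial (Fin 4) k →+* _).comp φ = RingHom.id _ := by
      ext <;> simp [φ, ψ]
    exact DFunLike.congr_fun this p
  have heval : ∀ p, aeval ![y, z, 0, 0] (φ p) = Polynomial.aeval z p := by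
    intro p
    have : (aeval ![y, z, 0, 0] : MvPolynomial (Fin 4) k →ₐ[k] Ω).toRingHom.comp φ =
        (Polynomial.aeval z : Polynomial (Polynomial k) →ₐ[Polynomial k] Ω).toRingHom := by
      ext <;> simp [φ, hmap]
    exact DFunLike.congr_fun this p
  obtain ⟨Δ, hΔ⟩ : ∃ Δ, Δ = variationalDeriv κ (s ^ 2) (α * s) (-(β * r)) (-(r ^ 2)) := ⟨_, rfl⟩
  have hrange : ∀ p, Δ (φ p) ∈ φ.range := by
    have hC : ∀ a : k, Δ (C a) ∈ φ.range := fun a =>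
      ⟨Polynomial.C (Polynomial.X ^ 2 * Polynomial.C (κ a)), by
        simp [hΔ, variationalDeriv_apply, coeffDeriv_C, hφC, hφ0]; ring⟩
    have h0 : Δ (X 0) ∈ φ.range := ⟨Polynomial.C (Polynomial.X ^ 3) * Polynomial.X, by
      simp [hΔ, variationalDeriv_apply, coeffDeriv_X, hφ0, hφ1, pderiv_X]⟩
    have h1 : Δ (X 1) ∈ φ.range := ⟨Polynomial.C (Polynomial.C (s ^ 2) * Polynomial.X ^ 4 +
      Polynomial.C (α * s) * Polynomial.X ^ 3 + Polynomial.C (-(β * r)) * Polynomial.X +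
      Polynomial.C (-(r ^ 2))), by
      simp only [hΔ, variationalDeriv_apply, coeffDeriv_X, Polynomial.C_mul,
        Polynomial.C_pow, map_add, map_mul φ, map_pow φ, hφ0, hφC]
      simp [pderiv_X]⟩
    have hmul : ∀ p q, Δ (φ p) ∈ φ.range → Δ (φ q) ∈ φ.range → Δ (φ (p * q)) ∈ φ.range := by
      intro p q hp hq
      rw [map_mul, Derivation.leibniz, smul_eq_mul, smul_eq_mul]
      exact add_mem (mul_mem (φ.mem_range_self p) hq) (mul_mem (φ.mem_range_self q) hp)
    have hadd : ∀ p q, Δ (φ p) ∈ φ.range → Δ (φ q) ∈ φ.range → Δ (φ (p + q)) ∈ φ.range := by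
      intro p q hp hq
      rw [map_add, map_add]
      exact add_mem hp hq
    have hCC : ∀ p : Polynomial k, Δ (φ (Polynomial.C p)) ∈ φ.range := by
      intro p
      induction p using Polynomial.induction_on with
      | C a => rw [hφC]; exact hC a
      | add p q hp hq => rw [map_add]; exact hadd _ _ hp hq
      | monomial n a ih =>
        rw [pow_succ, ← mul_assoc, map_mul]
        exact hmul _ _ ih (by rwa [hφ0])
    intro p
    induction p using Polynomial.induction_on with
    | C a => exact hCC a
    | add p q hp hq => exact hadd _ _ hp hq
    | monomial n a ih =>
      rw [pow_succ, ← mul_assoc]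
      exact hmul _ _ ih (by rwa [hφ1])
  obtain ⟨Q, hQ⟩ := hrange P
  have hQz : Polynomial.aeval z Q = 0 := by
    have := hx.aeval_variationalDeriv h (φ P)
    rw [← hΔ, ← hQ, heval, heval, hPz, map_zero, mul_zero] at this
    exact this
  obtain ⟨c, e, hce⟩ := eq_C_mul_X_pow_of_dvd_variationalDeriv κ s r α β hg.s_ne_zero
    hg.r_ne_zero hg.s_deriv hg.r_deriv hg.α_deriv hg.β_deriv hg.generic
    (A := φ P) (fun h0 => hP0 (by rw [← hψ P, h0, map_zero]))
    (by rw [← hΔ, ← hQ]; exact map_dvd φ (hP Q hQz))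
  have h1 := heval P
  rw [hPz, hce, map_mul, map_pow, aeval_C, aeval_X, Matrix.cons_val_zero] at h1
  have hc : c = 0 := by simpa [hy0] using h1
  exact hP0 (by rw [← hψ P, hce, hc, C_0, zero_mul, map_zero])

/-- A constant of the field generated by a generic point of the variational equation is a rational
function of its first coordinate. -/
theorem IsVariationalSolution.mem_adjoin_of_deriv_eq_zero {x : Fin 4 → Ω}
    (hg : IsGenericParam κ s r α β)
    (h : ∀ a, d (algebraMap k Ω a) = algebraMap k Ω (κ a))
    (hx : IsVariationalSolution s r α β d x) (hxi : AlgebraicIndependent k x) {c : Ω}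
    (hc : c ∈ IntermediateField.adjoin k (Set.range x)) (hdc : d c = 0) :
    c ∈ IntermediateField.adjoin k {x 0} := by
  by_cases hc0 : c = 0
  · rw [hc0]; exact zero_mem _
  obtain ⟨A, B, hAB⟩ := (IntermediateField.mem_adjoin_range_iff k x c).1 hc
  have hA : A ≠ 0 := by rintro rfl; simp [hAB] at hc0
  have hB : B ≠ 0 := by rintro rfl; simp [hAB] at hc0
  obtain ⟨A', B', C', hrel, hA', hB'⟩ := UniqueFactorizationMonoid.exists_reduced_factors A hA B
  have hC' : C' ≠ 0 := by rintro rfl; simp at hA'; exact hA hA'.symm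
  have hA'0 : A' ≠ 0 := by rintro rfl; simp at hA'; exact hA hA'.symm
  have hB'0 : B' ≠ 0 := by rintro rfl; simp at hB'; exact hB hB'.symm
  have hinj : ∀ P : MvPolynomial (Fin 4) k, aeval x P = 0 → P = 0 := fun P hP =>
    hxi (by rw [hP, map_zero])
  have hB'x : aeval x B' ≠ 0 := fun h0 => hB'0 (hinj _ h0)
  have hC'x : aeval x C' ≠ 0 := fun h0 => hC' (hinj _ h0)
  have hcAB : c * aeval x B' = aeval x A' := by
    rw [hAB, ← hA', ← hB', map_mul, map_mul]
    field_simp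
  set Δ := variationalDeriv κ (s ^ 2) (α * s) (-(β * r)) (-(r ^ 2)) with hΔ
  have hΔx := hx.aeval_variationalDeriv h
  rw [← hΔ] at hΔx
  have heq : Δ A' * B' = A' * Δ B' := by
    rw [← sub_eq_zero]
    apply hinj
    have := congr(d $hcAB)
    rw [Derivation.leibniz, hdc, smul_zero, add_zero, smul_eq_mul] at this
    rw [map_sub, map_mul, map_mul, hΔx, hΔx, ← this, ← hcAB]
    ring
  have hdA : A' ∣ Δ A' := hrel.dvd_of_dvd_mul_right ⟨Δ B', heq⟩
  have hdB : B' ∣ Δ B' := hrel.symm.dvd_of_dvd_mul_left ⟨Δ A', by rw [← heq, mul_comm]⟩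
  have key : ∀ {P : MvPolynomial (Fin 4) k}, P ≠ 0 → P ∣ Δ P →
      aeval x P ∈ IntermediateField.adjoin k {x 0} := by
    intro P hP hdP
    obtain ⟨a, e, rfl⟩ := eq_C_mul_X_pow_of_dvd_variationalDeriv κ s r α β hg.s_ne_zero
      hg.r_ne_zero hg.s_deriv hg.r_deriv hg.α_deriv hg.β_deriv hg.generic hP hdP
    rw [map_mul, map_pow, aeval_C, aeval_X]
    exact mul_mem (IntermediateField.algebraMap_mem _ _)
      (pow_mem (IntermediateField.mem_adjoin_simple_self k (x 0)) e)
  rw [← mul_div_cancel_right₀ c hB'x, hcAB]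
  exact div_mem (key hA'0 hdA) (key hB'0 hdB)

end

section

variable {k Ω : Type*} [Field k] [Field Ω] [Algebra k Ω]

/-- The restriction of a derivation to a stable intermediate field. -/
theorem IntermediateField.exists_derivation_restrict (F : IntermediateField k Ω)
    (d : Derivation ℤ Ω Ω) (hF : ∀ a ∈ F, d a ∈ F) :
    ∃ D : Derivation ℤ F F, ∀ a : F, d a = D a :=
  ⟨Derivation.mk'
    { toFun := fun a => ⟨d a, hF a a.2⟩
      map_add' := fun _ _ => Subtype.ext (map_add d _ _)
      map_smul' := fun n _ => Subtype.ext (map_zsmul d n _) }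
    (fun _ _ => Subtype.ext (d.leibniz _ _)), fun _ => rfl⟩

theorem IntermediateField.deriv_mem_adjoin {S : Set Ω} (d : Derivation ℤ Ω Ω)
    (F : IntermediateField k Ω) (hk : ∀ a : k, d (algebraMap k Ω a) ∈ F)
    (hS : ∀ a ∈ S, d a ∈ F) (hSF : adjoin k S ≤ F) {a : Ω} (ha : a ∈ adjoin k S) : d a ∈ F := by
  induction ha using IntermediateField.adjoin_induction with
  | mem a ha => exact hS a ha
  | algebraMap a => exact hk a
  | add _ _ _ _ ha hb => rw [map_add]; exact add_mem ha hb
  | inv a ha' ha =>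
    rw [Derivation.leibniz_inv]
    exact mul_mem (neg_mem (pow_mem (inv_mem (hSF ha')) 2)) ha
  | mul a b ha' hb' ha hb =>
    rw [Derivation.leibniz]
    exact add_mem (mul_mem (hSF ha') hb) (mul_mem (hSF hb') ha)

theorem IntermediateField.deriv_eq_zero_of_mem_adjoin {S : Set Ω} (d : Derivation ℤ Ω Ω)
    (hk : ∀ a : k, d (algebraMap k Ω a) = 0)
    (hS : ∀ a ∈ S, d a = 0) {a : Ω} (ha : a ∈ adjoin k S) : d a = 0 := by
  induction ha using IntermediateField.adjoin_induction with
  | mem a ha => exact hS a ha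
  | algebraMap a => exact hk a
  | add _ _ _ _ ha hb => rw [map_add, ha, hb, add_zero]
  | inv _ _ ha => rw [Derivation.leibniz_inv, ha, smul_zero]
  | mul _ _ _ _ ha hb => rw [Derivation.leibniz, ha, hb, smul_zero, smul_zero, add_zero]

/-- A derivation vanishing on `k` and on `S` vanishes on everything algebraic over `k(S)`. -/
theorem Derivation.eq_zero_of_isAlgebraic_adjoin [CharZero k] (d : Derivation ℤ Ω Ω) {S : Set Ω}
    (hk : ∀ a : k, d (algebraMap k Ω a) = 0) (hS : ∀ a ∈ S, d a = 0) {a : Ω}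
    (ha : IsAlgebraic (IntermediateField.adjoin k S) a) : d a = 0 :=
  Derivation.eq_zero_of_isAlgebraic d
    (fun b => IntermediateField.deriv_eq_zero_of_mem_adjoin d hk hS b.2) ha

variable {κ : Derivation ℤ k k} {s r α β : k} {d : Derivation ℤ Ω Ω}

theorem IsVariationalSolution.deriv_mem_adjoin {x : Fin 4 → Ω}
    (h : ∀ a, d (algebraMap k Ω a) = algebraMap k Ω (κ a))
    (hx : IsVariationalSolution s r α β d x) {a : Ω}
    (ha : a ∈ IntermediateField.adjoin k (Set.range x)) :
    d a ∈ IntermediateField.adjoin k (Set.range x) := by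
  have hmem : ∀ i, x i ∈ IntermediateField.adjoin k (Set.range x) := fun i =>
    IntermediateField.subset_adjoin _ _ ⟨i, rfl⟩
  have hk : ∀ c : k, algebraMap k Ω c ∈ IntermediateField.adjoin k (Set.range x) :=
    fun c => IntermediateField.algebraMap_mem _ c
  have hdiv : ∀ {u v : Ω}, x 0 ^ 2 * u = v → v ∈ IntermediateField.adjoin k (Set.range x) →
      u ∈ IntermediateField.adjoin k (Set.range x) := by
    intro u v huv hv
    rw [← mul_div_cancel_left₀ u (pow_ne_zero 2 hx.y_ne_zero), huv]
    exact div_mem hv (pow_mem (hmem 0) 2)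
  refine IntermediateField.deriv_mem_adjoin d _ (fun c => ?_) ?_ le_rfl ha
  · rw [h]; exact hk _
  rintro _ ⟨i, rfl⟩
  fin_cases i
  · exact hx.y_deriv ▸ mul_mem (hmem 0) (hmem 1)
  · refine hdiv hx.z_deriv (add_mem (add_mem (add_mem ?_ ?_) ?_) (hk _)) <;>
      exact mul_mem (hk _) (by first | exact pow_mem (hmem 0) _ | exact hmem 0)
  · exact hx.ξ_deriv ▸ hmem 3
  · refine hdiv hx.η_deriv (mul_mem (add_mem (add_mem (add_mem ?_ ?_) ?_) (hk _)) (hmem 2)) <;>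
      exact mul_mem (hk _) (by first | exact pow_mem (hmem 0) _ | exact hmem 0)

/-- A constant algebraic over a generic point of the variational equation is algebraic over its
first coordinate. -/
theorem IsVariationalSolution.isAlgebraic_of_deriv_eq_zero [CharZero k] {x : Fin 4 → Ω}
    (hg : IsGenericParam κ s r α β)
    (h : ∀ a, d (algebraMap k Ω a) = algebraMap k Ω (κ a))
    (hx : IsVariationalSolution s r α β d x) (hxi : AlgebraicIndependent k x) {w : Ω}
    (hw : IsAlgebraic (IntermediateField.adjoin k (Set.range x)) w) (hdw : d w = 0) :
    IsAlgebraic (IntermediateField.adjoin k {x 0}) w := by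
  obtain ⟨D, hD⟩ := (IntermediateField.adjoin k (Set.range x)).exists_derivation_restrict d
    (fun a ha => hx.deriv_mem_adjoin h ha)
  have hco := Derivation.coeff_minpoly_eq_zero D d hD hw hdw
  set m := minpoly (IntermediateField.adjoin k (Set.range x)) w with hm
  have hmem : ∀ i, ((m.coeff i : IntermediateField.adjoin k (Set.range x)) : Ω) ∈
      IntermediateField.adjoin k {x 0} := fun i =>
    hx.mem_adjoin_of_deriv_eq_zero hg h hxi (m.coeff i).2 (by rw [hD, hco]; rfl)
  have hlift : m.map (algebraMap _ Ω) ∈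
      Polynomial.lifts (algebraMap (IntermediateField.adjoin k {x 0}) Ω) := by
    rw [Polynomial.lifts_iff_coeff_lifts]
    intro i
    rw [Polynomial.coeff_map]
    exact ⟨⟨_, hmem i⟩, rfl⟩
  obtain ⟨q, hq⟩ := (Polynomial.mem_lifts _).1 hlift
  refine ⟨q, ?_, ?_⟩
  · rintro rfl
    rw [Polynomial.map_zero] at hq
    exact minpoly.ne_zero hw.isIntegral ((Polynomial.map_eq_zero _).1 hq.symm)
  · rw [Polynomial.aeval_def, ← Polynomial.eval_map, hq, Polynomial.eval_map,
      ← Polynomial.aeval_def, hm, minpoly.aeval]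

end

theorem IsGenericParam.map {k F : Type*} [Field k] [Field F] {κ : Derivation ℤ k k}
    {κ' : Derivation ℤ F F} {s r α β : k} (hg : IsGenericParam κ s r α β) (f : k →+* F)
    (hf : ∀ a, κ' (f a) = f (κ a)) : IsGenericParam κ' (f s) (f r) (f α) (f β) where
  s_ne_zero := (map_ne_zero f).2 hg.s_ne_zero
  r_ne_zero := (map_ne_zero f).2 hg.r_ne_zero
  s_deriv := by rw [hf, hg.s_deriv]
  r_deriv := by rw [hf, hg.r_deriv]
  α_deriv := by rw [hf, hg.α_deriv, map_zero]
  β_deriv := by rw [hf, hg.β_deriv, map_zero]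
  generic a m m' h := hg.generic a m m' (f.injective (by simpa [map_ofNat] using h))

section

variable {k L : Type*} [Field k] [Field L] [Algebra k L] {s r α β : k} {d : Derivation ℤ L L}

theorem IsVariationalSolution.deriv_deriv_z {y z a : L}
    (hx : IsVariationalSolution s r α β d ![y, z, 0, 0]) (V : Derivation ℤ L L)
    (hV : ∀ c, V (algebraMap k L c) = 0) (ha : V y = a * y) :
    y ^ 2 * V (d z) = (algebraMap k L (2 * s ^ 2) * y ^ 4 + algebraMap k L (α * s) * y ^ 3
      + algebraMap k L (-(-(β * r))) * y + algebraMap k L (-2 * -(r ^ 2))) * a := by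
  have h0 : y ≠ 0 := hx.y_ne_zero
  have h1 : y ^ 2 * d z = algebraMap k L (s ^ 2) * y ^ 4 + algebraMap k L (α * s) * y ^ 3
    + algebraMap k L (-(β * r)) * y + algebraMap k L (-(r ^ 2)) := hx.z_deriv
  have h2 := congr(V $h1)
  simp only [Derivation.leibniz, map_add, Derivation.leibniz_pow, hV, ha, smul_eq_mul,
    nsmul_eq_mul, mul_zero, add_zero] at h2
  simp only [map_mul, map_neg, map_pow, map_ofNat] at h1 h2 ⊢
  push_cast at h2
  linear_combination h2 - 2 * a * h1

/-- If two solutions `y₁, y₃` are interalgebraic, then the logarithmic tangent vectors correspond by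
a linear map compatible with the linearised equations. -/
theorem IsVariationalSolution.exists_tangent_map [CharZero k] {κ : Derivation ℤ k k}
    (h : ∀ a, d (algebraMap k L a) = algebraMap k L (κ a)) {y₁ z₁ y₃ z₃ g₁ g₃ : L}
    (hx₁ : IsVariationalSolution s r α β d ![y₁, z₁, 0, 0])
    (hx₃ : IsVariationalSolution s r α β d ![y₃, z₃, 0, 0])
    (hg₁ : y₁ ^ 2 * g₁ = algebraMap k L (2 * s ^ 2) * y₁ ^ 4 + algebraMap k L (α * s) * y₁ ^ 3
      + algebraMap k L (-(-(β * r))) * y₁ + algebraMap k L (-2 * -(r ^ 2)))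
    (hg₃ : y₃ ^ 2 * g₃ = algebraMap k L (2 * s ^ 2) * y₃ ^ 4 + algebraMap k L (α * s) * y₃ ^ 3
      + algebraMap k L (-(-(β * r))) * y₃ + algebraMap k L (-2 * -(r ^ 2)))
    (hi : AlgebraicIndependent k ![y₁, z₁])
    (hy₃ : IsAlgebraic (IntermediateField.adjoin k {y₁, z₁}) y₃)
    (hz₃ : IsAlgebraic (IntermediateField.adjoin k {y₁, z₁}) z₃)
    (hy₁ : IsAlgebraic (IntermediateField.adjoin k {y₃, z₃}) y₁) :
    ∃ a b a' b' : L, IsAlgebraic (IntermediateField.adjoin k {y₁, z₁}) a ∧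
      IsAlgebraic (IntermediateField.adjoin k {y₁, z₁}) b ∧
      IsAlgebraic (IntermediateField.adjoin k {y₁, z₁}) a' ∧
      IsAlgebraic (IntermediateField.adjoin k {y₁, z₁}) b' ∧
      d a = a' - g₁ * b ∧ d b = b' - a ∧ d a' = g₃ * a - g₁ * b' ∧ d b' = g₃ * b - a' ∧
      ¬ (a = 0 ∧ a' = 0) := by
  have hy₁0 : y₁ ≠ 0 := hx₁.y_ne_zero
  have hy₃0 : y₃ ≠ 0 := hx₃.y_ne_zero
  have hdy₁ : d y₁ = y₁ * z₁ := hx₁.y_deriv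
  have hdy₃ : d y₃ = y₃ * z₃ := hx₃.y_deriv
  set E := IntermediateField.adjoin k {y₁, z₁} with hE
  have hy₁E : y₁ ∈ E := IntermediateField.subset_adjoin _ _ (by simp)
  have hz₁E : z₁ ∈ E := IntermediateField.subset_adjoin _ _ (by simp)
  obtain ⟨V₀, hV₀⟩ := hi.exists_derivation ![y₁, 0]
  obtain ⟨W₀, hW₀⟩ := hi.exists_derivation ![0, 1]
  obtain ⟨V, hVV⟩ : ∃ V : Derivation ℤ L L, ∀ a, V a = V₀ a := ⟨V₀.restrictScalars ℤ, fun _ => rfl⟩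
  obtain ⟨W, hWW⟩ : ∃ W : Derivation ℤ L L, ∀ a, W a = W₀ a := ⟨W₀.restrictScalars ℤ, fun _ => rfl⟩
  have hVk : ∀ c : k, V (algebraMap k L c) = 0 := fun c => by rw [hVV, V₀.map_algebraMap]
  have hWk : ∀ c : k, W (algebraMap k L c) = 0 := fun c => by rw [hWW, W₀.map_algebraMap]
  have hVy : V y₁ = y₁ := by simpa [hVV] using hV₀ 0
  have hVz : V z₁ = 0 := by simpa [hVV] using hV₀ 1
  have hWy : W y₁ = 0 := by simpa [hWW] using hW₀ 0
  have hWz : W z₁ = 1 := by simpa [hWW] using hW₀ 1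
  have key : ∀ U : Derivation ℤ L L, (∀ a : E, U a ∈ E) → ∀ m, IsAlgebraic E m →
      IsAlgebraic E (U m) := by
    intro U hU m hm
    obtain ⟨U', hU'⟩ := E.exists_derivation_restrict U (fun a ha => hU ⟨a, ha⟩)
    exact Derivation.isAlgebraic_apply U' U hU' hm
  have hVyE : V y₁ ∈ E := by rwa [hVy]
  have hVE : ∀ a : E, V a ∈ E := fun a =>
    IntermediateField.deriv_mem_adjoin V E (fun c => by rw [hVk]; exact zero_mem _)
      (by rintro _ (rfl | rfl); exacts [hVyE, hVz ▸ zero_mem _]) le_rfl a.2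
  have hWE : ∀ a : E, W a ∈ E := fun a =>
    IntermediateField.deriv_mem_adjoin W E (fun c => by rw [hWk]; exact zero_mem _)
      (by rintro _ (rfl | rfl); exacts [hWy ▸ zero_mem _, hWz ▸ one_mem _]) le_rfl a.2
  have hzero : ∀ U : Derivation ℤ L L, (∀ c : k, U (algebraMap k L c) = 0) → U y₁ = 0 →
      U z₁ = 0 → ∀ m, IsAlgebraic E m → U m = 0 := fun U hk hy hz m hm =>
    Derivation.eq_zero_of_isAlgebraic_adjoin U hk
      (by rintro _ (rfl | rfl); exacts [hy, hz]) hm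
  have hVdz : V (d z₁) = g₁ := by
    have := hx₁.deriv_deriv_z V hVk (a := 1) (by rw [hVy, one_mul])
    rw [← hg₁, mul_one] at this
    exact mul_left_cancel₀ (pow_ne_zero 2 hy₁0) this
  have hWdz : W (d z₁) = 0 := by
    have := hx₁.deriv_deriv_z W hWk (a := 0) (by rw [hWy, zero_mul])
    rw [mul_zero] at this
    exact (mul_eq_zero.1 this).resolve_left (pow_ne_zero 2 hy₁0)
  have hcV : ∀ m, IsAlgebraic E m → d (V m) = V (d m) - g₁ * W m := by
    intro m hm
    have := hzero (⁅d, V⁆ + g₁ • W) ?_ ?_ ?_ m hm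
    · rw [Derivation.add_apply, Derivation.commutator_apply, Derivation.smul_apply,
        smul_eq_mul] at this
      linear_combination this
    · intro c
      simp [Derivation.commutator_apply, h, hVk, hWk]
    · simp [Derivation.commutator_apply, hVy, hWy, hdy₁, hVz, mul_comm]
    · simp [Derivation.commutator_apply, hVz, hWz, hVdz]
  have hcW : ∀ m, IsAlgebraic E m → d (W m) = W (d m) - V m := by
    intro m hm
    have := hzero (⁅d, W⁆ + V) ?_ ?_ ?_ m hm
    · rw [Derivation.add_apply, Derivation.commutator_apply] at this
      linear_combination this
    · intro c
      simp [Derivation.commutator_apply, h, hVk, hWk]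
    · simp [Derivation.commutator_apply, hVy, hWy, hdy₁, hWz]
    · simp [Derivation.commutator_apply, hVz, hWz, hWdz]
  have hVy₃ : V y₃ = V y₃ / y₃ * y₃ := (div_mul_cancel₀ _ hy₃0).symm
  have hWy₃ : W y₃ = W y₃ / y₃ * y₃ := (div_mul_cancel₀ _ hy₃0).symm
  have hVdz₃ : V (d z₃) = g₃ * (V y₃ / y₃) := by
    have := hx₃.deriv_deriv_z V hVk hVy₃
    rw [← hg₃, mul_assoc] at this
    exact mul_left_cancel₀ (pow_ne_zero 2 hy₃0) this
  have hWdz₃ : W (d z₃) = g₃ * (W y₃ / y₃) := by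
    have := hx₃.deriv_deriv_z W hWk hWy₃
    rw [← hg₃, mul_assoc] at this
    exact mul_left_cancel₀ (pow_ne_zero 2 hy₃0) this
  refine ⟨V y₃ / y₃, W y₃ / y₃, V z₃, W z₃, ?_, ?_, key V hVE _ hz₃, key W hWE _ hz₃,
    ?_, ?_, ?_, ?_, ?_⟩
  · rw [div_eq_mul_inv]; exact (key V hVE _ hy₃).mul hy₃.inv
  · rw [div_eq_mul_inv]; exact (key W hWE _ hy₃).mul hy₃.inv
  · have h1 := hcV _ hy₃
    rw [hdy₃, Derivation.leibniz, smul_eq_mul, smul_eq_mul] at h1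
    rw [Derivation.leibniz_div, hdy₃, h1]
    simp only [smul_eq_mul]
    field_simp
    ring
  · have h1 := hcW _ hy₃
    rw [hdy₃, Derivation.leibniz, smul_eq_mul, smul_eq_mul] at h1
    rw [Derivation.leibniz_div, hdy₃, h1]
    simp only [smul_eq_mul]
    field_simp
    ring
  · rw [hcV _ hz₃, hVdz₃]
  · rw [hcW _ hz₃, hWdz₃]
  · rintro ⟨ha, ha'⟩
    have := Derivation.eq_zero_of_isAlgebraic_adjoin V hVk (S := {y₃, z₃})
      (by rintro _ (rfl | rfl); exacts [(div_eq_zero_iff.1 ha).resolve_right hy₃0, ha']) hy₁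
    exact hy₁0 (hVy ▸ this)

end

section

open MvPolynomial

universe u v

variable {ι : Type u} {L : Type v} [Field L]

theorem Derivation.exists_extension_isFractionRing_mvPolynomial {Ω : Type*} [Field Ω]
    [Algebra (MvPolynomial ι L) Ω] [IsFractionRing (MvPolynomial ι L) Ω]
    (d : Derivation ℤ L L) (c : ι → MvPolynomial ι L) :
    ∃ D : Derivation ℤ Ω Ω,
      (∀ a, D (algebraMap (MvPolynomial ι L) Ω (C a)) = algebraMap (MvPolynomial ι L) Ω (C (d a))) ∧
      ∀ i, D (algebraMap (MvPolynomial ι L) Ω (X i)) = algebraMap (MvPolynomial ι L) Ω (c i) := by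
  obtain ⟨D, hD⟩ := Derivation.exists_extension_isFractionRing (Ω := Ω)
    (coeffDeriv d + (mkDerivation L c).restrictScalars ℤ)
  have hD' : ∀ p, D (algebraMap (MvPolynomial ι L) Ω p) =
      algebraMap (MvPolynomial ι L) Ω (coeffDeriv d p + mkDerivation L c p) := hD
  refine ⟨D, fun a => ?_, fun i => ?_⟩
  · rw [hD', coeffDeriv_C, MvPolynomial.derivation_C, add_zero]
  · rw [hD', coeffDeriv_X, mkDerivation_X, zero_add]

/-- A derivation of a field extends to a purely transcendental extension, with prescribed polynomial
values on the generators. -/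
theorem Derivation.exists_extension_purelyTranscendental (d : Derivation ℤ L L)
    (c : ι → MvPolynomial ι L) :
    ∃ (Ω : Type (max u v)) (_ : Field Ω) (_ : Algebra L Ω) (x : ι → Ω) (D : Derivation ℤ Ω Ω),
      AlgebraicIndependent L x ∧ (∀ a, D (algebraMap L Ω a) = algebraMap L Ω (d a)) ∧
      ∀ i, D (x i) = aeval x (c i) := by
  obtain ⟨D, hC, hX⟩ := Derivation.exists_extension_isFractionRing_mvPolynomial
    (Ω := FractionRing (MvPolynomial ι L)) d c
  have haeval : ∀ p, aeval (fun i => algebraMap (MvPolynomial ι L)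
      (FractionRing (MvPolynomial ι L)) (X i)) p = algebraMap _ _ p := fun p =>
    DFunLike.congr_fun (MvPolynomial.algHom_ext (g := Algebra.algHom L (MvPolynomial ι L)
      (FractionRing (MvPolynomial ι L))) (fun i => by rw [aeval_X]; rfl)) p
  refine ⟨FractionRing (MvPolynomial ι L), inferInstance, inferInstance,
    fun i => algebraMap (MvPolynomial ι L) _ (X i), D, ?_, ?_, ?_⟩
  · intro p q hpq
    rw [haeval, haeval] at hpq
    exact IsFractionRing.injective _ _ hpq
  · intro a
    have h1 := IsScalarTower.algebraMap_apply L (MvPolynomial ι L)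
      (FractionRing (MvPolynomial ι L))
    rw [h1, h1]
    exact hC a
  · intro i
    rw [haeval]
    exact hX i

end

section

theorem IntermediateField.algebraMap_mem_of_mem_adjoin {k L F Ω : Type*} [Field k] [Field L]
    [Algebra k L] [Field F] [Field Ω] [Algebra F Ω] (f : L →+* Ω) (E : IntermediateField F Ω)
    {S : Set L} (hk : ∀ c : k, f (algebraMap k L c) ∈ E) (hS : ∀ a ∈ S, f a ∈ E) {a : L}
    (ha : a ∈ adjoin k S) : f a ∈ E := by
  induction ha using IntermediateField.adjoin_induction with
  | mem a ha => exact hS a ha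
  | algebraMap a => exact hk a
  | add a b _ _ ha hb => rw [map_add]; exact add_mem ha hb
  | inv a _ ha => rw [map_inv₀]; exact inv_mem ha
  | mul a b _ _ ha hb => rw [map_mul]; exact mul_mem ha hb

theorem IsAlgebraic.map_of_forall_mem {k L F Ω : Type*} [Field k] [Field L]
    [Algebra k L] [Field F] [Field Ω] [Algebra F Ω] (f : L →+* Ω) {E : IntermediateField k L}
    {E' : IntermediateField F Ω} (hE : ∀ a ∈ E, f a ∈ E') {a : L} (ha : IsAlgebraic E a) :
    IsAlgebraic E' (f a) :=
  IsAlgebraic.ringHom_of_comp_eq (R := E) (S := E') (A := L) (B := Ω)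
    ((f.comp E.val.toRingHom).codRestrict E' fun a => hE a a.2) f ha
    (RingHom.injective _) (by ext; rfl)

open MvPolynomial in
/-- A nonzero linear map between the linearised equations at a generic solution and at a rational
solution is impossible. -/
theorem IsVariationalSolution.tangent_map_eq_zero {k L : Type*} [Field k] [CharZero k] [Field L]
    [Algebra k L] {κ : Derivation ℤ k k} {s r α β : k} {d : Derivation ℤ L L}
    (hg : IsGenericParam κ s r α β)
    (h : ∀ a, d (algebraMap k L a) = algebraMap k L (κ a)) {y₁ z₁ g₁ a b a' b' : L} {g₃ : k}
    (hx₁ : IsVariationalSolution s r α β d ![y₁, z₁, 0, 0])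
    (hg₁ : y₁ ^ 2 * g₁ = algebraMap k L (2 * s ^ 2) * y₁ ^ 4 + algebraMap k L (α * s) * y₁ ^ 3
      + algebraMap k L (-(-(β * r))) * y₁ + algebraMap k L (-2 * -(r ^ 2)))
    (hi : AlgebraicIndependent k ![y₁, z₁])
    (haE : IsAlgebraic (IntermediateField.adjoin k {y₁, z₁}) a)
    (hbE : IsAlgebraic (IntermediateField.adjoin k {y₁, z₁}) b)
    (haE' : IsAlgebraic (IntermediateField.adjoin k {y₁, z₁}) a')
    (hbE' : IsAlgebraic (IntermediateField.adjoin k {y₁, z₁}) b')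
    (hda : d a = a' - g₁ * b) (hdb : d b = b' - a)
    (hda' : d a' = algebraMap k L g₃ * a - g₁ * b') (hdb' : d b' = algebraMap k L g₃ * b - a') :
    a = 0 ∧ a' = 0 := by
  have : CharZero L := charZero_of_injective_algebraMap (algebraMap k L).injective
  obtain ⟨Ω, _, _, x, D, hxi, hDL, hDx⟩ := Derivation.exists_extension_purelyTranscendental d
    ![X 1, C (algebraMap k L g₃) * X 0, X 3, C g₁ * X 2]
  let _ : Algebra k Ω := ((algebraMap L Ω).comp (algebraMap k L)).toAlgebra
  have : IsScalarTower k L Ω := IsScalarTower.of_algebraMap_eq fun _ => rfl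
  have hkΩ : ∀ c, algebraMap k Ω c = algebraMap L Ω (algebraMap k L c) := fun _ => rfl
  have hD0 : D (x 0) = x 1 := by simpa using hDx 0
  have hD1 : D (x 1) = algebraMap k Ω g₃ * x 0 := by simpa [hkΩ] using hDx 1
  have hD2 : D (x 2) = x 3 := by simpa using hDx 2
  have hD3 : D (x 3) = algebraMap L Ω g₁ * x 2 := by simpa using hDx 3
  have hDk : ∀ c : k, D (algebraMap k Ω c) = algebraMap k Ω (κ c) := fun c => by
    rw [hkΩ, hDL, h, hkΩ]
  set F := IntermediateField.adjoin k (Set.range ![x 0, x 1]) with hF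
  have hx0F : x 0 ∈ F := IntermediateField.subset_adjoin _ _ ⟨0, rfl⟩
  have hx1F : x 1 ∈ F := IntermediateField.subset_adjoin _ _ ⟨1, rfl⟩
  obtain ⟨κF, hκF⟩ := F.exists_derivation_restrict D fun e he => by
    refine IntermediateField.deriv_mem_adjoin D F (fun c => ?_) ?_ le_rfl he
    · rw [hDk]; exact F.algebraMap_mem _
    · rintro _ ⟨i, rfl⟩
      fin_cases i
      · simpa [hD0] using hx1F
      · simpa [hD1] using mul_mem (F.algebraMap_mem g₃) hx0F
  have hgF : IsGenericParam κF (algebraMap k F s) (algebraMap k F r) (algebraMap k F α)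
      (algebraMap k F β) := hg.map _ fun c => Subtype.ext (by
    rw [← hκF]; exact hDk c)
  set v : Fin 4 → Ω := ![algebraMap L Ω y₁, algebraMap L Ω z₁, x 2, x 3] with hv
  have hvi : AlgebraicIndependent F v := by
    have h1 : AlgebraicIndependent k (Sum.elim x (algebraMap L Ω ∘ ![y₁, z₁])) :=
      hi.sumElim_comp hxi
    let e : Fin 4 ⊕ Fin 2 → Fin 4 ⊕ Fin 2 :=
      Sum.elim ![Sum.inr 0, Sum.inr 1, Sum.inl 2, Sum.inl 3] ![Sum.inl 0, Sum.inl 1]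
    have he : Function.Injective e := by decide
    have h2 := h1.comp e he
    have h3 : Sum.elim x (algebraMap L Ω ∘ ![y₁, z₁]) ∘ e = Sum.elim v ![x 0, x 1] := by
      ext i
      rcases i with i | i <;> fin_cases i <;> rfl
    rw [h3, AlgebraicIndependent.sumElim_iff] at h2
    rw [hF, IntermediateField.algebraicIndependent_adjoin_iff]
    exact h2.2
  have hFL : ∀ c : k, algebraMap F Ω (algebraMap k F c) = algebraMap L Ω (algebraMap k L c) :=
    fun _ => rfl
  have hvs : IsVariationalSolution (algebraMap k F s) (algebraMap k F r) (algebraMap k F α)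
      (algebraMap k F β) D v := by
    refine ⟨?_, ?_, ?_, hD2, ?_⟩
    · exact (map_ne_zero _).2 hx₁.y_ne_zero
    · change D (algebraMap L Ω y₁) = algebraMap L Ω y₁ * algebraMap L Ω z₁
      rw [hDL, ← map_mul]
      exact congrArg _ hx₁.y_deriv
    · change algebraMap L Ω y₁ ^ 2 * D (algebraMap L Ω z₁) = _ * algebraMap L Ω y₁ ^ 4 +
        _ * algebraMap L Ω y₁ ^ 3 + _ * algebraMap L Ω y₁ + _
      have := congrArg (algebraMap L Ω) hx₁.z_deriv
      simp only [← map_mul, ← map_pow, ← map_neg, hFL, hDL, ← map_add]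
      exact this
    · change algebraMap L Ω y₁ ^ 2 * D (x 3) = (_ * algebraMap L Ω y₁ ^ 4 +
        _ * algebraMap L Ω y₁ ^ 3 + _ * algebraMap L Ω y₁ + _) * x 2
      rw [hD3, ← mul_assoc]
      congr 1
      have := congrArg (algebraMap L Ω) hg₁
      have h2 : (2 : F) = algebraMap k F 2 := (map_ofNat _ 2).symm
      simp only [h2, ← map_mul, ← map_pow, ← map_neg, hFL, ← map_add]
      exact this
  have hmem : ∀ i, v i ∈ IntermediateField.adjoin F (Set.range v) := fun i =>
    IntermediateField.subset_adjoin _ _ ⟨i, rfl⟩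
  have halg : ∀ m : L, IsAlgebraic (IntermediateField.adjoin k {y₁, z₁}) m →
      IsAlgebraic (IntermediateField.adjoin F (Set.range v)) (algebraMap L Ω m) := by
    intro m hm
    refine hm.map_of_forall_mem (algebraMap L Ω) fun e he => ?_
    refine IntermediateField.algebraMap_mem_of_mem_adjoin (algebraMap L Ω) _ (fun c => ?_) ?_ he
    · rw [← hFL]; exact IntermediateField.algebraMap_mem _ _
    · rintro u (rfl | rfl)
      exacts [hmem 0, hmem 1]
  have halgv : ∀ i, IsAlgebraic (IntermediateField.adjoin F (Set.range v)) (v i) := fun i =>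
    isAlgebraic_algebraMap (⟨v i, hmem i⟩ : IntermediateField.adjoin F (Set.range v))
  have halgF : ∀ u ∈ F, IsAlgebraic (IntermediateField.adjoin F (Set.range v)) u := fun u hu =>
    isAlgebraic_algebraMap (⟨u, IntermediateField.algebraMap_mem _ (⟨u, hu⟩ : F)⟩ :
      IntermediateField.adjoin F (Set.range v))
  set A := algebraMap L Ω a with hA
  set B := algebraMap L Ω b with hB
  set A' := algebraMap L Ω a' with hA'
  set B' := algebraMap L Ω b' with hB'
  set w := x 0 * (A' * x 2 + B' * x 3) - x 1 * (A * x 2 + B * x 3) with hw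
  have hwalg : IsAlgebraic (IntermediateField.adjoin F (Set.range v)) w :=
    ((halgF _ hx0F).mul (((halg _ haE').mul (halgv 2)).add ((halg _ hbE').mul (halgv 3)))).sub
      ((halgF _ hx1F).mul (((halg _ haE).mul (halgv 2)).add ((halg _ hbE).mul (halgv 3))))
  have hDw : D w = 0 := by
    have e1 : D A = A' - algebraMap L Ω g₁ * B := by rw [hA, hDL, hda, map_sub, map_mul]
    have e2 : D B = B' - A := by rw [hB, hDL, hdb, map_sub]
    have e3 : D A' = algebraMap k Ω g₃ * A - algebraMap L Ω g₁ * B' := by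
      rw [hA', hDL, hda', map_sub, map_mul, map_mul, hkΩ]
    have e4 : D B' = algebraMap k Ω g₃ * B - A' := by
      rw [hB', hDL, hdb', map_sub, map_mul, hkΩ]
    simp only [hw, map_sub, map_add, Derivation.leibniz, smul_eq_mul, e1, e2, e3, e4, hD0, hD1,
      hD2, hD3]
    ring
  have hwv := hvs.isAlgebraic_of_deriv_eq_zero hgF hκF hvi hwalg hDw
  have hdual : ∀ c : Fin 4 → Ω, ∃ P : Derivation ℤ Ω Ω, (∀ m, P (algebraMap L Ω m) = 0) ∧
      ∀ i, P (x i) = c i := by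
    intro c
    obtain ⟨P, hP⟩ := hxi.exists_derivation c
    exact ⟨P.restrictScalars ℤ, fun m => P.map_algebraMap m, hP⟩
  obtain ⟨P, hPL, hP⟩ := hdual ![0, 0, 1, 0]
  obtain ⟨P₀, hPL₀, hP₀⟩ := hdual ![1, 0, 0, 0]
  obtain ⟨P₁, hPL₁, hP₁⟩ := hdual ![0, 1, 0, 0]
  have hP0 : P (x 0) = 0 := hP 0
  have hP1 : P (x 1) = 0 := hP 1
  have hP2 : P (x 2) = 1 := hP 2
  have hP3 : P (x 3) = 0 := hP 3
  have hPF : ∀ c : F, P (algebraMap F Ω c) = 0 := fun c =>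
    IntermediateField.deriv_eq_zero_of_mem_adjoin P (fun c => by rw [hkΩ, hPL])
      (by rintro _ ⟨i, rfl⟩; fin_cases i; exacts [hP0, hP1]) c.2
  have hPw : P w = 0 := Derivation.eq_zero_of_isAlgebraic_adjoin P hPF
    (by rintro _ rfl; exact hPL y₁) hwv
  have hrel : x 0 * A' - x 1 * A = 0 := by
    rw [← hPw, hw]
    simp only [map_sub, map_add, Derivation.leibniz, smul_eq_mul, hP0, hP1, hP2, hP3]
    simp only [hA, hA', hB, hB', hPL]
    ring
  have hP00 : P₀ (x 0) = 1 := hP₀ 0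
  have hP01 : P₀ (x 1) = 0 := hP₀ 1
  have hP10 : P₁ (x 0) = 0 := hP₁ 0
  have hP11 : P₁ (x 1) = 1 := hP₁ 1
  have hA0 : A' = 0 := by
    have := congr(P₀ $hrel)
    simpa [Derivation.leibniz, hP00, hP01, hA, hA', hPL₀] using this
  have hA1 : A = 0 := by
    have := congr(P₁ $hrel)
    simpa [Derivation.leibniz, hP10, hP11, hA, hA', hPL₁] using this
  exact ⟨(map_eq_zero _).1 hA1, (map_eq_zero _).1 hA0⟩

end

namespace Matroid

variable {σ ι : Type*} {M : Matroid σ} {y z : ι → σ}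

/-- The points determined by the pairs `(y j, z j)`, `j ∈ S`. -/
def pairClosure (M : Matroid σ) (y z : ι → σ) (S : Set ι) : Set σ :=
  M.closure (y '' S ∪ z '' S)

theorem pairClosure_insert (p : ι) (S : Set ι) : M.pairClosure y z (insert p S) =
    M.closure (insert (y p) (insert (z p) (y '' S ∪ z '' S))) := by
  rw [pairClosure, Set.image_insert_eq, Set.image_insert_eq, Set.insert_union, Set.union_insert]

theorem pairClosure_mono {S T : Set ι} (h : S ⊆ T) :
    M.pairClosure y z S ⊆ M.pairClosure y z T :=
  M.closure_subset_closure (Set.union_subset_union (Set.image_mono h) (Set.image_mono h))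

/-- Each pair is either independent from or contained in the closure of any set of pairs. -/
structure IsDichotomous (M : Matroid σ) (y z : ι → σ) : Prop where
  ground_eq : M.E = Set.univ
  snd_mem : ∀ S i, y i ∈ M.pairClosure y z S → z i ∈ M.pairClosure y z S
  fst_mem : ∀ S i, z i ∈ M.closure (insert (y i) (y '' S ∪ z '' S)) → y i ∈ M.pairClosure y z S

theorem IsDichotomous.pairClosure_subset (h : M.IsDichotomous y z) {S T : Set ι}
    (hST : ∀ i ∈ S, y i ∈ M.pairClosure y z T) : M.pairClosure y z S ⊆ M.pairClosure y z T := by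
  refine M.closure_subset_closure_of_subset_closure (Set.union_subset ?_ ?_)
  · rintro _ ⟨i, hi, rfl⟩
    exact hST i hi
  · rintro _ ⟨i, hi, rfl⟩
    exact h.snd_mem T i (hST i hi)

theorem IsDichotomous.fst_mem_of_mem (h : M.IsDichotomous y z) {S : Set ι} {i : ι} (hi : i ∈ S) :
    y i ∈ M.pairClosure y z S :=
  M.mem_closure_of_mem (Or.inl ⟨i, hi, rfl⟩) (by rw [h.ground_eq]; exact Set.subset_univ _)

theorem IsDichotomous.exchange (h : M.IsDichotomous y z) {S : Set ι} {i p : ι}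
    (hip : y i ∈ M.pairClosure y z (insert p S)) (hi : y i ∉ M.pairClosure y z S) :
    y p ∈ M.pairClosure y z (insert i S) := by
  rw [pairClosure_insert, Set.insert_comm] at hip
  have hsub : insert (y i) (y '' S ∪ z '' S) ⊆ y '' insert i S ∪ z '' insert i S := by
    rw [Set.image_insert_eq, Set.image_insert_eq, Set.insert_union]
    exact Set.insert_subset_insert (Set.union_subset_union_right _ (Set.subset_insert _ _))
  by_cases hy : y i ∈ M.closure (insert (y p) (y '' S ∪ z '' S))
  · exact M.closure_subset_closure hsub (closure_exchange ⟨hy, hi⟩).1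
  · refine h.fst_mem _ _ (M.closure_subset_closure ?_ (closure_exchange ⟨hip, hy⟩).1)
    rw [Set.insert_comm]
    exact Set.insert_subset_insert hsub

/-- If no three pairs are in general relative position, dependence is detected on single pairs. -/
theorem IsDichotomous.exists_mem_pairClosure_singleton (h : M.IsDichotomous y z)
    (htriv : ∀ S p q i, y i ∈ M.pairClosure y z (insert p (insert q S)) →
      y p ∈ M.pairClosure y z (insert i (insert q S)) →
      y q ∈ M.pairClosure y z (insert i (insert p S)) →
      y p ∉ M.pairClosure y z (insert q S) → y p ∉ M.pairClosure y z (insert i S) → False)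
    {i : ι} {T : Finset ι} (hT : y i ∈ M.pairClosure y z T) :
    y i ∈ M.pairClosure y z ∅ ∨ ∃ j ∈ T, y i ∈ M.pairClosure y z {j} := by
  classical
  have step : ∀ S p q, y i ∈ M.pairClosure y z (insert p (insert q S)) →
      y i ∈ M.pairClosure y z (insert p S) ∨ y i ∈ M.pairClosure y z (insert q S) := by
    intro S p q hi
    by_contra! hcon
    obtain ⟨hip, hiq⟩ := hcon
    have hpS : y p ∉ M.pairClosure y z (insert q S) := fun hp =>
      hiq (h.pairClosure_subset (by
        rintro j (rfl | hj)
        exacts [hp, h.fst_mem_of_mem hj]) hi)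
    refine htriv S p q i hi (h.exchange hi hiq) (h.exchange (by rwa [Set.insert_comm]) hip)
      hpS fun hp => hip (h.exchange hp fun hp' => hpS ?_)
    exact pairClosure_mono (Set.subset_insert _ _) hp'
  induction T using Finset.strongInduction with
  | H T ih =>
    rcases T.eq_empty_or_nonempty with rfl | ⟨p, hp⟩
    · exact Or.inl (by simpa using hT)
    obtain ⟨S, hpS, rfl⟩ : ∃ S, p ∉ S ∧ T = insert p S :=
      ⟨T.erase p, Finset.notMem_erase p T, (Finset.insert_erase hp).symm⟩
    have sub : ∀ R : Finset ι, R ⊂ insert p S → y i ∈ M.pairClosure y z R →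
        y i ∈ M.pairClosure y z ∅ ∨ ∃ j ∈ insert p S, y i ∈ M.pairClosure y z {j} := by
      intro R hR hi
      exact (ih R hR hi).imp_right fun ⟨j, hj, hj'⟩ => ⟨j, hR.subset hj, hj'⟩
    rcases S.eq_empty_or_nonempty with rfl | ⟨q, hq⟩
    · exact Or.inr ⟨p, hp, by simpa using hT⟩
    obtain ⟨R, hqR, rfl⟩ : ∃ R, q ∉ R ∧ S = insert q R :=
      ⟨S.erase q, Finset.notMem_erase q S, (Finset.insert_erase hq).symm⟩
    rcases step R p q (by simpa using hT) with h1 | h1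
    · refine sub (insert p R) ?_ (by simpa using h1)
      rw [Finset.insert_comm]
      refine Finset.ssubset_insert fun hq' => ?_
      rcases Finset.mem_insert.1 hq' with rfl | hq'
      exacts [hpS hq, hqR hq']
    · exact sub (insert q R) (Finset.ssubset_insert hpS) (by simpa using h1)

end Matroid

namespace AlgebraicIndependent

variable {k L ι : Type*} [Field k] [Field L] [Algebra k L] {x : ι → L}

theorem of_forall_notMem_closure
    (h : ∀ i, x i ∉ (matroid k L).closure (x '' {i}ᶜ)) : AlgebraicIndependent k x := by
  refine algebraicIndependent_of_finite_type' (algebraMap k L).injective fun t _ _ i hi => ?_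
  intro halg
  refine h i ((matroid k L).closure_subset_closure (Set.image_mono (s := t) ?_) ?_)
  · rintro j hj rfl
    exact hi hj
  · rwa [matroid_closure_eq, SetLike.mem_coe, Subalgebra.mem_algebraicClosure]

theorem notMem_closure (hx : AlgebraicIndependent k x) {i : ι} {s : Set ι} (hi : i ∉ s) :
    x i ∉ (matroid k L).closure (x '' s) := by
  rw [matroid_closure_eq, SetLike.mem_coe, Subalgebra.mem_algebraicClosure]
  exact hx.transcendental_adjoin hi

/-- Dependence of a dichotomous family of pairs comes from one pair depending on the others. -/
theorem exists_mem_pairClosure_compl {y z w : ι → L} (h : (matroid k L).IsDichotomous y z)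
    (hz : ∀ i, z i ∈ (matroid k L).closure {y i, w i})
    (hw : ∀ i, w i ∈ (matroid k L).closure {y i, z i})
    (hdep : ¬ AlgebraicIndependent k (Sum.elim y w)) :
    ∃ i, y i ∈ (matroid k L).pairClosure y z {i}ᶜ := by
  by_contra! hcon
  have hw' : ∀ i, w i ∉ (matroid k L).closure (insert (y i) (y '' {i}ᶜ ∪ z '' {i}ᶜ)) := by
    intro i hi
    refine hcon i (h.fst_mem _ _ ?_)
    refine (matroid k L).closure_subset_closure_of_subset_closure ?_ (hz i)
    rintro _ (rfl | rfl)
    · exact (matroid k L).mem_closure_of_mem (Set.mem_insert _ _)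
    · exact hi
  have hwsub : ∀ i, w '' {i}ᶜ ⊆ (matroid k L).pairClosure y z {i}ᶜ := by
    rintro i _ ⟨j, hj, rfl⟩
    refine (matroid k L).closure_subset_closure ?_ (hw j)
    rintro _ (rfl | rfl)
    exacts [Or.inl ⟨j, hj, rfl⟩, Or.inr ⟨j, hj, rfl⟩]
  have hysub : ∀ i, y '' {i}ᶜ ⊆ (matroid k L).pairClosure y z {i}ᶜ := fun i =>
    Set.subset_union_left.trans ((matroid k L).subset_closure _)
  refine hdep (of_forall_notMem_closure ?_)
  rintro (i | i) hi
  · have h1 : y i ∈ (matroid k L).closure (insert (w i) (y '' {i}ᶜ ∪ z '' {i}ᶜ)) := by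
      refine (matroid k L).closure_subset_closure_of_subset_closure ?_ hi
      have hmono := (matroid k L).closure_subset_closure
        (Set.subset_insert (w i) (y '' {i}ᶜ ∪ z '' {i}ᶜ))
      rintro _ ⟨j | j, hj, rfl⟩
      · exact hmono (hysub i ⟨j, fun hji => hj (congrArg Sum.inl hji), rfl⟩)
      · by_cases hji : j = i
        · subst hji
          exact (matroid k L).mem_closure_of_mem (Set.mem_insert _ _)
        · exact hmono (hwsub i ⟨j, hji, rfl⟩)
    exact hw' i (Matroid.closure_exchange ⟨h1, hcon i⟩).1
  · refine hw' i ?_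
    refine (matroid k L).closure_subset_closure_of_subset_closure ?_ hi
    have hmono := (matroid k L).closure_subset_closure
      (Set.subset_insert (y i) (y '' {i}ᶜ ∪ z '' {i}ᶜ))
    rintro _ ⟨j | j, hj, rfl⟩
    · by_cases hji : j = i
      · subst hji
        exact (matroid k L).mem_closure_of_mem (Set.mem_insert _ _)
      · exact hmono (hysub i ⟨j, hji, rfl⟩)
    · exact hmono (hwsub i ⟨j, fun hji => hj (congrArg Sum.inr hji), rfl⟩)

end AlgebraicIndependent

section

variable {k L : Type*} [Field k] [Field L] [Algebra k L]

theorem IntermediateField.isAlgebraic_adjoin_adjoin_iff {S X : Set L} {m : L} :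
    IsAlgebraic (adjoin (adjoin k S) X) m ↔ IsAlgebraic (adjoin k (S ∪ X)) m := by
  refine ⟨fun hm => hm.map_of_forall_mem (RingHom.id L) fun e he => ?_,
    fun hm => hm.map_of_forall_mem (RingHom.id L) fun e he => ?_⟩
  · refine algebraMap_mem_of_mem_adjoin (RingHom.id L) _ (fun c => ?_) (fun a ha => ?_) he
    · exact adjoin.mono k S (S ∪ X) Set.subset_union_left c.2
    · exact subset_adjoin _ _ (Or.inr ha)
  · refine algebraMap_mem_of_mem_adjoin (RingHom.id L) _ (fun c => ?_) (fun a ha => ?_) he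
    · exact IntermediateField.algebraMap_mem _ (algebraMap k (adjoin k S) c)
    · rcases ha with ha | ha
      · exact IntermediateField.algebraMap_mem _ (⟨a, subset_adjoin _ _ ha⟩ : adjoin k S)
      · exact subset_adjoin _ _ ha

/-- The potential of the linearised equation at `y`. -/
noncomputable def linearPotential (s r α β : k) (y : L) : L :=
  (algebraMap k L (2 * s ^ 2) * y ^ 4 + algebraMap k L (α * s) * y ^ 3
    + algebraMap k L (-(-(β * r))) * y + algebraMap k L (-2 * -(r ^ 2))) / y ^ 2

variable {s r α β : k}

theorem linearPotential_mem (F : IntermediateField k L) {y : L} (hy : y ∈ F) :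
    linearPotential s r α β y ∈ F := by
  have hk : ∀ c : k, algebraMap k L c ∈ F := F.algebraMap_mem
  exact div_mem (add_mem (add_mem (add_mem (mul_mem (hk _) (pow_mem hy _))
    (mul_mem (hk _) (pow_mem hy _))) (mul_mem (hk _) hy)) (hk _)) (pow_mem hy _)

theorem sq_mul_linearPotential (F : Type*) [Field F] [Algebra k F] [Algebra F L]
    [IsScalarTower k F L] {y : L} (hy : y ≠ 0) :
    y ^ 2 * linearPotential s r α β y = algebraMap F L (2 * algebraMap k F s ^ 2) * y ^ 4
      + algebraMap F L (algebraMap k F α * algebraMap k F s) * y ^ 3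
      + algebraMap F L (-(-(algebraMap k F β * algebraMap k F r))) * y
      + algebraMap F L (-2 * -(algebraMap k F r ^ 2)) := by
  rw [linearPotential, mul_div_cancel₀ _ (pow_ne_zero 2 hy)]
  simp only [map_mul, map_neg, map_pow, map_ofNat, IsScalarTower.algebraMap_apply k F L]

variable {κ : Derivation ℤ k k} {d : Derivation ℤ L L}

theorem IsVariationalSolution.baseChange (F : Type*) [Field F] [Algebra k F] [Algebra F L]
    [IsScalarTower k F L] {x : Fin 4 → L} (hx : IsVariationalSolution s r α β d x) :
    IsVariationalSolution (algebraMap k F s) (algebraMap k F r) (algebraMap k F α)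
      (algebraMap k F β) d x where
  y_ne_zero := hx.y_ne_zero
  y_deriv := hx.y_deriv
  z_deriv := by rw [hx.z_deriv]; simp only [map_mul, map_neg, map_pow, IsScalarTower.algebraMap_apply k F L]
  ξ_deriv := hx.ξ_deriv
  η_deriv := by rw [hx.η_deriv]; simp only [map_mul, map_neg, map_pow, map_ofNat, IsScalarTower.algebraMap_apply k F L]

variable {ι : Type*} {y z : ι → L}

open AlgebraicIndependent

theorem mem_pairClosure_iff {S : Set ι} {m : L} : m ∈ (matroid k L).pairClosure y z S ↔
    IsAlgebraic (IntermediateField.adjoin k (y '' S ∪ z '' S)) m :=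
  mem_matroid_closure_iff

theorem mem_pairClosure_insert_iff {S : Set ι} {p : ι} {m : L} :
    m ∈ (matroid k L).pairClosure y z (insert p S) ↔
    IsAlgebraic (IntermediateField.adjoin (IntermediateField.adjoin k (y '' S ∪ z '' S))
      {y p, z p}) m := by
  rw [Matroid.pairClosure_insert, IntermediateField.isAlgebraic_adjoin_adjoin_iff,
    mem_matroid_closure_iff, Set.union_comm _ {y p, z p}, Set.insert_union, Set.singleton_union]

/-- The field generated by solutions is again a base field for the equation. -/
theorem exists_derivation_adjoin_solutions (hg : IsGenericParam κ s r α β)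
    (h : ∀ a, d (algebraMap k L a) = algebraMap k L (κ a))
    (hx : ∀ i, IsVariationalSolution s r α β d ![y i, z i, 0, 0]) (S : Set ι) :
    let F := IntermediateField.adjoin k (y '' S ∪ z '' S)
    ∃ κ' : Derivation ℤ F F, (∀ a, d (algebraMap F L a) = algebraMap F L (κ' a)) ∧
      IsGenericParam κ' (algebraMap k F s) (algebraMap k F r) (algebraMap k F α)
        (algebraMap k F β) := by
  intro F
  have hsub : ∀ i ∈ S, ∀ a, a ∈ IntermediateField.adjoin k (Set.range ![y i, z i, 0, 0]) →
      a ∈ F := by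
    intro i hi a ha
    have hle : IntermediateField.adjoin k (Set.range ![y i, z i, 0, 0]) ≤ F := by
      rw [IntermediateField.adjoin_le_iff]
      rintro _ ⟨j, rfl⟩
      fin_cases j
      · exact IntermediateField.subset_adjoin _ _ (Or.inl ⟨i, hi, rfl⟩)
      · exact IntermediateField.subset_adjoin _ _ (Or.inr ⟨i, hi, rfl⟩)
      · exact zero_mem F
      · exact zero_mem F
    exact hle ha
  obtain ⟨κ', hκ'⟩ := F.exists_derivation_restrict d fun a ha =>
    IntermediateField.deriv_mem_adjoin d F (fun c => by rw [h]; exact F.algebraMap_mem _)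
      (by
        rintro _ (⟨i, hi, rfl⟩ | ⟨i, hi, rfl⟩)
        · exact hsub i hi _ ((hx i).deriv_mem_adjoin h
            (IntermediateField.subset_adjoin _ _ ⟨0, rfl⟩))
        · exact hsub i hi _ ((hx i).deriv_mem_adjoin h
            (IntermediateField.subset_adjoin _ _ ⟨1, rfl⟩))) le_rfl ha
  exact ⟨κ', hκ', hg.map (algebraMap k F) fun a => Subtype.ext (by rw [← hκ']; exact h a)⟩

theorem algebraicIndependent_of_notMem_pairClosure [CharZero k] (hg : IsGenericParam κ s r α β)
    (h : ∀ a, d (algebraMap k L a) = algebraMap k L (κ a))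
    (hx : ∀ i, IsVariationalSolution s r α β d ![y i, z i, 0, 0]) {S : Set ι} {i : ι}
    (hi : ¬ (y i ∈ (matroid k L).pairClosure y z S ∧ z i ∈ (matroid k L).pairClosure y z S)) :
    AlgebraicIndependent (IntermediateField.adjoin k (y '' S ∪ z '' S)) ![y i, z i] := by
  obtain ⟨κ', hκ', hg'⟩ := exists_derivation_adjoin_solutions hg h hx S
  by_contra hdep
  rw [mem_pairClosure_iff, mem_pairClosure_iff] at hi
  exact hi (((hx i).baseChange _).isAlgebraic_of_not_algebraicIndependent hg' hκ' hdep)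

theorem isDichotomous_solutions [CharZero k] (hg : IsGenericParam κ s r α β)
    (h : ∀ a, d (algebraMap k L a) = algebraMap k L (κ a))
    (hx : ∀ i, IsVariationalSolution s r α β d ![y i, z i, 0, 0]) :
    (matroid k L).IsDichotomous y z where
  ground_eq := rfl
  snd_mem S i hi := by
    by_contra hz
    have := algebraicIndependent_of_notMem_pairClosure hg h hx fun hh => hz hh.2
    exact this.transcendental 0 (mem_pairClosure_iff.1 hi)
  fst_mem S i hi := by
    by_contra hy
    have := algebraicIndependent_of_notMem_pairClosure hg h hx fun hh => hy hh.1
    have h1 := this.notMem_closure (i := 1) (s := {0}) (by simp)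
    rw [mem_matroid_closure_iff, Set.image_singleton,
      IntermediateField.isAlgebraic_adjoin_adjoin_iff, ← mem_matroid_closure_iff] at h1
    rw [Set.union_singleton] at h1
    exact h1 hi

/-- Three solutions cannot be in general relative position. -/
theorem not_general_position_solutions [CharZero k] (hg : IsGenericParam κ s r α β)
    (h : ∀ a, d (algebraMap k L a) = algebraMap k L (κ a))
    (hx : ∀ i, IsVariationalSolution s r α β d ![y i, z i, 0, 0]) (S : Set ι) (p q i : ι)
    (hi : y i ∈ (matroid k L).pairClosure y z (insert p (insert q S)))
    (hp : y p ∈ (matroid k L).pairClosure y z (insert i (insert q S)))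
    (hq : y q ∈ (matroid k L).pairClosure y z (insert i (insert p S)))
    (hpq : y p ∉ (matroid k L).pairClosure y z (insert q S))
    (hpi : y p ∉ (matroid k L).pairClosure y z (insert i S)) : False := by
  have hdich := isDichotomous_solutions hg h hx
  obtain ⟨κ₂, hκ₂, hg₂⟩ := exists_derivation_adjoin_solutions hg h hx (insert q S)
  obtain ⟨κ₃, hκ₃, hg₃⟩ := exists_derivation_adjoin_solutions hg h hx (insert i S)
  have hi₂ := algebraicIndependent_of_notMem_pairClosure hg h hx fun hh => hpq hh.1
  have hi₃ := algebraicIndependent_of_notMem_pairClosure hg h hx fun hh => hpi hh.1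
  obtain ⟨a, b, a', b', ha, hb, ha', hb', hda, hdb, hda', hdb', hne⟩ :=
    IsVariationalSolution.exists_tangent_map hκ₂ ((hx p).baseChange _) ((hx i).baseChange _)
      (sq_mul_linearPotential _ (hx p).y_ne_zero) (sq_mul_linearPotential _ (hx i).y_ne_zero)
      hi₂ (mem_pairClosure_insert_iff.1 hi)
      (mem_pairClosure_insert_iff.1 (hdich.snd_mem _ _ hi)) (mem_pairClosure_insert_iff.1 hp)
  have hsub : ∀ m : L, IsAlgebraic (IntermediateField.adjoin (IntermediateField.adjoin k
        (y '' insert q S ∪ z '' insert q S)) {y p, z p}) m →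
      IsAlgebraic (IntermediateField.adjoin (IntermediateField.adjoin k
        (y '' insert i S ∪ z '' insert i S)) {y p, z p}) m := by
    intro m hm
    rw [← mem_pairClosure_insert_iff] at hm ⊢
    refine hdich.pairClosure_subset ?_ hm
    rintro j (rfl | rfl | hj)
    · exact hdich.fst_mem_of_mem (Set.mem_insert _ _)
    · rwa [Set.insert_comm]
    · exact hdich.fst_mem_of_mem (Set.mem_insert_of_mem _ (Set.mem_insert_of_mem _ hj))
  have hmem : linearPotential s r α β (y i) ∈ IntermediateField.adjoin k
      (y '' insert i S ∪ z '' insert i S) :=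
    linearPotential_mem _ (IntermediateField.subset_adjoin _ _
      (Or.inl ⟨i, Set.mem_insert _ _, rfl⟩))
  exact hne (((hx p).baseChange _).tangent_map_eq_zero hg₃ hκ₃ (g₃ := ⟨_, hmem⟩)
    (sq_mul_linearPotential _ (hx p).y_ne_zero) hi₃ (hsub a ha) (hsub b hb) (hsub a' ha')
    (hsub b' hb') hda hdb hda' hdb')

/-- Dependence among solutions of a generic equation is detected on pairs. -/
theorem exists_mem_closure_pair_of_solutions [CharZero k] [Finite ι] [Nontrivial ι]
    (hg : IsGenericParam κ s r α β)
    (h : ∀ a, d (algebraMap k L a) = algebraMap k L (κ a))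
    (hx : ∀ i, IsVariationalSolution s r α β d ![y i, z i, 0, 0]) {w : ι → L}
    (hz : ∀ i, z i ∈ (matroid k L).closure {y i, w i})
    (hw : ∀ i, w i ∈ (matroid k L).closure {y i, z i})
    (hdep : ¬ AlgebraicIndependent k (Sum.elim y w)) :
    ∃ i j, i ≠ j ∧ y i ∈ (matroid k L).closure {y j, w j} := by
  have hdich := isDichotomous_solutions hg h hx
  obtain ⟨i, hi⟩ := exists_mem_pairClosure_compl hdich hz hw hdep
  obtain ⟨T, hT⟩ := ({i}ᶜ : Set ι).toFinite.exists_finset_coe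
  rw [← hT] at hi
  obtain ⟨j, hij, hj⟩ : ∃ j, i ≠ j ∧ y i ∈ (matroid k L).pairClosure y z {j} := by
    rcases hdich.exists_mem_pairClosure_singleton
      (fun S p q i => not_general_position_solutions hg h hx S p q i) hi with h0 | ⟨j, hj, h1⟩
    · obtain ⟨j, hj⟩ := exists_ne i
      exact ⟨j, hj.symm, Matroid.pairClosure_mono (Set.empty_subset _) h0⟩
    · have hj' : j ∈ (T : Set ι) := hj
      rw [hT] at hj'
      exact ⟨j, fun hji => hj' hji.symm, h1⟩
  refine ⟨i, j, hij, (matroid k L).closure_subset_closure_of_subset_closure ?_ hj⟩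
  rw [Set.image_singleton, Set.image_singleton]
  rintro _ (rfl | rfl)
  · exact (matroid k L).mem_closure_of_mem (Set.mem_insert _ _)
  · exact hz j

end

section

open MvPolynomial

theorem eq_zero_of_algebraicIndependent_painleveIII {α β γ δ u v : ℂ}
    (hind : AlgebraicIndependent ℚ ![α, β, γ, δ]) (hu : u ^ 2 = γ) (hv : v ^ 2 = -δ) (a : ℕ)
    (m m' : ℤ) (h : 2 * (a : ℂ) + m * (α / u) + m' * (-(β / v)) = 0) : a = 0 := by
  have hγ : γ ≠ 0 := hind.ne_zero 2
  have hδ : δ ≠ 0 := hind.ne_zero 3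
  have hu0 : u ≠ 0 := by rintro rfl; exact hγ (by rw [← hu]; simp)
  have hv0 : v ≠ 0 := by rintro rfl; exact hδ (by simpa using hv.symm)
  have h1 : 2 * a * u * v = m' * β * u - m * α * v := by
    field_simp at h
    linear_combination h
  have h2 : (4 * (a : ℂ) ^ 2 * γ * -δ - m ^ 2 * α ^ 2 * -δ - m' ^ 2 * β ^ 2 * γ) ^ 2 =
      4 * m ^ 2 * m' ^ 2 * α ^ 2 * β ^ 2 * γ * -δ := by
    rw [← hu, ← hv]
    have h3 : 4 * (a : ℂ) ^ 2 * u ^ 2 * v ^ 2 - m ^ 2 * α ^ 2 * v ^ 2 - m' ^ 2 * β ^ 2 * u ^ 2 =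
        -2 * (m * α * v) * (m' * β * u) := by
      linear_combination (2 * a * u * v + (m' * β * u - m * α * v)) * h1
    rw [h3]
    ring
  have h4 : (C (4 * (a : ℚ) ^ 2) * X 2 * -X 3 - C ((m : ℚ) ^ 2) * X 0 ^ 2 * -X 3
      - C ((m' : ℚ) ^ 2) * X 1 ^ 2 * X 2) ^ 2 - C (4 * (m : ℚ) ^ 2 * (m' : ℚ) ^ 2)
      * X 0 ^ 2 * X 1 ^ 2 * X 2 * -X 3 = (0 : MvPolynomial (Fin 4) ℚ) := by
    apply hind
    rw [map_zero, ← sub_eq_zero.2 h2]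
    simp [aeval_X]
  have h5 := congrArg (eval ![0, 0, 1, 1]) h4
  simpa using h5

end

/-- A derivation of a field restricts to a stable subfield. -/
theorem Subfield.exists_derivation_restrict {L : Type*} [Field L] (K : Subfield L)
    (d : Derivation ℤ L L) (hK : ∀ a ∈ K, d a ∈ K) :
    ∃ D : Derivation ℤ K K, ∀ a : K, d a = D a :=
  ⟨Derivation.mk'
    { toFun := fun a => ⟨d a, hK a a.2⟩
      map_add' := fun _ _ => Subtype.ext (map_add d _ _)
      map_smul' := fun n _ => Subtype.ext (map_zsmul d n _) }
    (fun _ _ => Subtype.ext (d.leibniz _ _)), fun _ => rfl⟩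

/-- Geometric triviality of the generic third Painlevé equation: for `α, β, γ, δ ∈ ℂ`
algebraically independent over `ℚ`, if nonzero solutions `y₁, …, yₙ` of
`y'' = (1/y)(y')² − (1/t)y' + (1/t)(αy² + β) + γy³ + δ/y` are such that
`y₁, y₁', …, yₙ, yₙ'` are algebraically dependent over a differential subfield `K`, then
already some pair `yᵢ, yᵢ', yⱼ, yⱼ'` (`i < j`) is algebraically dependent over `K`. -/
theorem painleveIII_geometrically_trivial
    (α β γ δ : ℂ) (hind : AlgebraicIndependent ℚ ![α, β, γ, δ])
    (L : Type*) [Field L] [Algebra ℂ L]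
    (D : L → L)
    (hD_add : ∀ a b : L, D (a + b) = D a + D b)
    (hD_mul : ∀ a b : L, D (a * b) = a * D b + b * D a)
    (hD_const : ∀ c : ℂ, D (algebraMap ℂ L c) = 0)
    (t : L) (hDt : D t = 1)
    (K : Subfield L)
    (hK_const : ∀ c : ℂ, algebraMap ℂ L c ∈ K)
    (hK_t : t ∈ K)
    (hK_D : ∀ a ∈ K, D a ∈ K)
    (n : ℕ) (hn : 2 ≤ n)
    (y : Fin n → L) (hy0 : ∀ i : Fin n, y i ≠ 0)
    (hsol : ∀ i : Fin n,
      D (D (y i)) = (1 / y i) * (D (y i)) ^ 2 - (1 / t) * D (y i)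
        + (1 / t) * (algebraMap ℂ L α * (y i) ^ 2 + algebraMap ℂ L β)
        + algebraMap ℂ L γ * (y i) ^ 3 + algebraMap ℂ L δ / y i)
    (hdep : ¬ AlgebraicIndependent K (Sum.elim y (fun i => D (y i)))) :
    ∃ i j : Fin n, i < j ∧
      ¬ AlgebraicIndependent K ![y i, D (y i), y j, D (y j)] := by
  have : CharZero L := charZero_of_injective_algebraMap (algebraMap ℂ L).injective
  have : CharZero K := (algebraMap K L).charZero
  have : Nontrivial (Fin n) := Fin.nontrivial_iff_two_le.2 hn
  have ht0 : t ≠ 0 := by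
    rintro rfl
    have := hD_add 0 0
    rw [add_zero, hDt] at this
    simp at this
  obtain ⟨d, hd⟩ : ∃ d : Derivation ℤ L L, ∀ a, d a = t * D a :=
    ⟨t • Derivation.mk' (AddMonoidHom.mk' D hD_add).toIntLinearMap hD_mul, fun _ => rfl⟩
  obtain ⟨κ, hκ⟩ := K.exists_derivation_restrict d fun a ha => by
    rw [hd]; exact mul_mem hK_t (hK_D a ha)
  obtain ⟨u, hu⟩ := IsAlgClosed.exists_pow_nat_eq γ (n := 2) (by norm_num)
  obtain ⟨v, hv⟩ := IsAlgClosed.exists_pow_nat_eq (-δ) (n := 2) (by norm_num)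
  have hu0 : u ≠ 0 := by rintro rfl; exact hind.ne_zero 2 (by simp [← hu])
  have hv0 : v ≠ 0 := by rintro rfl; exact hind.ne_zero 3 (by simpa using hv.symm)
  let φ : ℂ →+* K := (algebraMap ℂ L).codRestrict K hK_const
  let τ : K := ⟨t, hK_t⟩
  have hφ : ∀ c, ((φ c : K) : L) = algebraMap ℂ L c := fun _ => rfl
  have hκφ : ∀ c, κ (φ c) = 0 := fun c => Subtype.ext (by rw [← hκ, hφ, hd, hD_const]; simp)
  have hκτ : κ τ = τ := Subtype.ext (by
    rw [← hκ, hd]; exact (congrArg _ hDt).trans (mul_one t))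
  have hτ0 : τ ≠ 0 := fun h0 => ht0 (congrArg Subtype.val h0)
  have hg : IsGenericParam κ (φ u * τ) (φ v * τ) (φ (α / u)) (φ (-(β / v))) :=
    { s_ne_zero := mul_ne_zero ((map_ne_zero φ).2 hu0) hτ0
      r_ne_zero := mul_ne_zero ((map_ne_zero φ).2 hv0) hτ0
      s_deriv := by rw [Derivation.leibniz, hκφ, hκτ]; simp
      r_deriv := by rw [Derivation.leibniz, hκφ, hκτ]; simp
      α_deriv := hκφ _
      β_deriv := hκφ _
      generic := fun a m m' h =>
        eq_zero_of_algebraicIndependent_painleveIII hind hu hv a m m' (φ.injective (by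
          rw [map_zero, ← h]
          simp only [map_add, map_mul, map_natCast, map_intCast, map_ofNat])) }
  have hx : ∀ i, IsVariationalSolution (φ u * τ) (φ v * τ) (φ (α / u)) (φ (-(β / v))) d
      ![y i, t * D (y i) / y i, 0, 0] := by
    intro i
    have hyz : y i * (t * D (y i) / y i) = t * D (y i) := mul_div_cancel₀ _ (hy0 i)
    have hcoef : ∀ c : K, algebraMap K L c = c := fun _ => rfl
    refine ⟨hy0 i, ?_, ?_, by simp, by simp⟩
    · change d (y i) = y i * (t * D (y i) / y i)
      rw [hd, hyz]
    · change y i ^ 2 * d (t * D (y i) / y i) = _ * y i ^ 4 + _ * y i ^ 3 + _ * y i + _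
      have h1 : y i * D (t * D (y i) / y i) + t * D (y i) / y i * D (y i) =
          t * D (D (y i)) + D (y i) * 1 := by
        rw [← hD_mul, hyz, hD_mul, hDt]
      have h2 : t * y i * D (D (y i)) = t * D (y i) ^ 2 - y i * D (y i)
          + y i * (algebraMap ℂ L α * (y i) ^ 2 + algebraMap ℂ L β)
          + t * algebraMap ℂ L γ * (y i) ^ 4 + t * algebraMap ℂ L δ := by
        rw [hsol i]
        have := hy0 i
        field_simp
      have hα : algebraMap K L (φ (α / u) * (φ u * τ)) = algebraMap ℂ L α * t := by
        rw [← mul_assoc, ← map_mul, div_mul_cancel₀ _ hu0]; rfl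
      have hβ : algebraMap K L (-(φ (-(β / v)) * (φ v * τ))) = algebraMap ℂ L β * t := by
        rw [← mul_assoc, ← map_mul, neg_mul, div_mul_cancel₀ _ hv0, map_neg φ, neg_mul, neg_neg]; rfl
      have hγ : algebraMap K L ((φ u * τ) ^ 2) = algebraMap ℂ L γ * t ^ 2 := by
        rw [mul_pow, ← map_pow, hu]; rfl
      have hδ : algebraMap K L (-((φ v * τ) ^ 2)) = algebraMap ℂ L δ * t ^ 2 := by
        rw [mul_pow, ← map_pow, hv, map_neg φ, neg_mul, neg_neg]; rfl
      rw [hα, hβ, hγ, hδ, hd]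
      linear_combination t * y i * h1 + t * h2 - t * D (y i) * hyz
  have hpair : ∀ a b : L, ∀ m ∈ IntermediateField.adjoin K {a, b},
      m ∈ (AlgebraicIndependent.matroid K L).closure {a, b} := fun a b m hm =>
    AlgebraicIndependent.mem_matroid_closure_iff.2 (isAlgebraic_algebraMap
      (⟨m, hm⟩ : IntermediateField.adjoin K {a, b}))
  have htmem : ∀ F : IntermediateField K L, t ∈ F := fun F => F.algebraMap_mem τ
  have hDmem : ∀ i, D (y i) ∈ IntermediateField.adjoin K {y i, t * D (y i) / y i} := by
    intro i
    have h1 := div_mem (mul_mem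
      (IntermediateField.subset_adjoin K {y i, t * D (y i) / y i} (Set.mem_insert _ _))
      (IntermediateField.subset_adjoin K {y i, t * D (y i) / y i} (Set.mem_insert_of_mem _ rfl)))
      (htmem _)
    rwa [mul_div_cancel₀ _ (hy0 i), mul_div_cancel_left₀ _ ht0] at h1
  obtain ⟨i, j, hij, hmem⟩ := exists_mem_closure_pair_of_solutions hg hκ hx
    (w := fun i => D (y i))
    (fun i => hpair _ _ _ (div_mem (mul_mem (htmem _)
      (IntermediateField.subset_adjoin _ _ (by simp)))
      (IntermediateField.subset_adjoin _ _ (by simp))))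
    (fun i => hpair _ _ _ (hDmem i))
    hdep
  rcases lt_or_gt_of_ne hij with hlt | hlt
  · refine ⟨i, j, hlt, fun hi => hi.notMem_closure (i := 0) (s := {2, 3}) (by simp) ?_⟩
    rw [Set.image_pair]
    exact hmem
  · refine ⟨j, i, hlt, fun hi => hi.notMem_closure (i := 2) (s := {0, 1}) (by simp) ?_⟩
    rw [Set.image_pair]
    exact hmem
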